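/- arXiv:2311.18524 — 3 statements merged into one kernel-verified Lean document; each statement's English description precedes it below -/
import Mathlib

section
/- There exists a constant c > 0 such that for every M ∈ {0,1}^{n×n} with rank(M) ≤ r and average degree d = |M|/n ≤ n/2, one has pdisc(M) ≥ c·min{dn, d^{1/2}n^{3/2}/√r}. -/
open Finset

/-- Symmetrization: the adjacency matrix `[[0, M],[Mᵀ, 0]]` of the bipartite graph of `M`. -/
noncomputable def symA {n : ℕ} (M : Matrix (Fin n) (Fin n) ℝ) :
    Matrix (Fin n ⊕ Fin n) (Fin n ⊕ Fin n) ℝ :=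
  Matrix.fromBlocks 0 M M.transpose 0

/-- The adjacency matrix of the complete bipartite graph `K_{n,n}`. -/
noncomputable def Lmat (n : ℕ) : Matrix (Fin n ⊕ Fin n) (Fin n ⊕ Fin n) ℝ :=
  symA (Matrix.of fun _ _ => (1 : ℝ))

/-- Frobenius inner product. -/
noncomputable def frob {n : ℕ} (X Y : Matrix (Fin n ⊕ Fin n) (Fin n ⊕ Fin n) ℝ) : ℝ :=
  ∑ k, ∑ l, X k l * Y k l

/-- Density `p = |M|/n²`. -/
noncomputable def dens {n : ℕ} (M : Matrix (Fin n) (Fin n) ℝ) : ℝ :=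
  (∑ i, ∑ j, M i j) / (n * n)

/-- `disc(X) = ⟨X,A⟩ - p⟨X,L⟩` for the SDP relaxation. -/
noncomputable def discX {n : ℕ} (M : Matrix (Fin n) (Fin n) ℝ)
    (X : Matrix (Fin n ⊕ Fin n) (Fin n ⊕ Fin n) ℝ) : ℝ :=
  frob X (symA M) - dens M * frob X (Lmat n)

/-- Vectors of norm at most one indexing the rows and columns give a feasible point of the
semidefinite program. -/
lemma exists_gram_discX {n m : ℕ} (M : Matrix (Fin n) (Fin n) ℝ) (U V : Matrix (Fin n) (Fin m) ℝ)
    (hU : ∀ i, ∑ k, U i k ^ 2 ≤ 1) (hV : ∀ j, ∑ k, V j k ^ 2 ≤ 1) :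
    ∃ X : Matrix (Fin n ⊕ Fin n) (Fin n ⊕ Fin n) ℝ, X.PosSemidef ∧ (∀ k, X k k ≤ 1) ∧
      discX M X = 2 * ∑ i, ∑ j, (M i j - dens M) * ∑ k, U i k * V j k := by
  refine ⟨Matrix.fromRows U V * (Matrix.fromRows U V).transpose, ?_, ?_, ?_⟩
  · simpa using Matrix.posSemidef_self_mul_conjTranspose (Matrix.fromRows U V)
  · rintro (i | j)
    · simpa [Matrix.mul_apply, pow_two] using hU i
    · simpa [Matrix.mul_apply, pow_two] using hV j
  · have h : ∀ N : Matrix (Fin n) (Fin n) ℝ,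
        frob (Matrix.fromRows U V * (Matrix.fromRows U V).transpose) (symA N)
          = 2 * ∑ i, ∑ j, N i j * ∑ k, U i k * V j k := by
      intro N
      simp only [frob, symA, Fintype.sum_sum_type, Matrix.mul_apply, Matrix.transpose_apply,
        Matrix.fromRows_apply_inl, Matrix.fromRows_apply_inr, Matrix.fromBlocks_apply₁₁,
        Matrix.fromBlocks_apply₁₂, Matrix.fromBlocks_apply₂₁, Matrix.fromBlocks_apply₂₂,
        Matrix.zero_apply, mul_zero, sum_const_zero, zero_add, add_zero]
      rw [sum_comm (f := fun i j => (∑ k, V i k * U j k) * N j i), two_mul]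
      simp only [mul_comm]
    rw [discX, Lmat, h, h]
    simp only [Matrix.of_apply, one_mul, sub_mul, sum_sub_distrib, ← mul_sum]
    ring

/-- Factorization of a matrix through an orthonormal basis of its row space. -/
lemma exists_orthonormal_factorization {n : ℕ} (M : Matrix (Fin n) (Fin n) ℝ) :
    ∃ (C : Matrix (Fin n) (Fin M.rank) ℝ) (D : Matrix (Fin M.rank) (Fin n) ℝ),
      (∀ i j, ∑ k, C i k * D k j = M i j) ∧ (∀ i, ∑ k, C i k ^ 2 = ∑ j, M i j ^ 2) ∧
      ∑ j, ∑ k, D k j ^ 2 = M.rank := by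
  let W : Submodule ℝ (EuclideanSpace ℝ (Fin n)) :=
    (Submodule.span ℝ (Set.range M.row)).map (WithLp.linearEquiv 2 ℝ (Fin n → ℝ)).symm.toLinearMap
  have hW : Module.finrank ℝ W = M.rank := by
    rw [Matrix.rank_eq_finrank_span_row]
    exact LinearEquiv.finrank_map_eq _ _
  let b : OrthonormalBasis (Fin M.rank) ℝ W := (stdOrthonormalBasis ℝ W).reindex (finCongr hW)
  let x : Fin n → W := fun i =>
    ⟨WithLp.toLp 2 (M i), Submodule.mem_map_of_mem (Submodule.subset_span ⟨i, rfl⟩)⟩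
  refine ⟨fun i k => inner ℝ (b k) (x i), fun k j => (b k : EuclideanSpace ℝ (Fin n)) j, ?_, ?_, ?_⟩
  · intro i j
    have h := congrArg (fun w : W => (w : EuclideanSpace ℝ (Fin n)) j) (b.sum_repr' (x i))
    simpa [x] using h
  · intro i
    have h := b.sum_sq_norm_inner_right (x i)
    simp only [Real.norm_eq_abs, sq_abs] at h
    rw [h, Submodule.coe_norm, EuclideanSpace.norm_sq_eq]
    simp [x]
  · rw [sum_comm]
    have h : ∀ k, ∑ j, (b k : EuclideanSpace ℝ (Fin n)) j ^ 2 = 1 := by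
      intro k
      have := b.orthonormal.1 k
      rw [Submodule.coe_norm] at this
      have h2 := EuclideanSpace.norm_sq_eq (b k : EuclideanSpace ℝ (Fin n))
      rw [this] at h2
      simpa using h2.symm
    simp [h]

/-- If the rows of at least twice the average degree carry a quarter of the ones, then they
witness discrepancy of the order of the number of ones. -/
lemma exists_discX_of_heavy_rows {n : ℕ} (M : Matrix (Fin n) (Fin n) ℝ) (hn : 0 < n)
    (h : (∑ i, ∑ j, M i j) / 4 ≤
      ∑ i, if 2 * ((∑ i, ∑ j, M i j) / n) ≤ ∑ j, M i j then ∑ j, M i j else 0) :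
    ∃ X : Matrix (Fin n ⊕ Fin n) (Fin n ⊕ Fin n) ℝ, X.PosSemidef ∧ (∀ k, X k k ≤ 1) ∧
      (∑ i, ∑ j, M i j) / 4 ≤ discX M X := by
  have hn' : (0 : ℝ) < n := by exact_mod_cast hn
  obtain ⟨X, hX, hd, he⟩ := exists_gram_discX M (m := 1)
    (fun i _ => if 2 * ((∑ i, ∑ j, M i j) / n) ≤ ∑ j, M i j then 1 else 0) (fun _ _ => 1)
    (by intro i; split_ifs <;> simp) (by simp)
  refine ⟨X, hX, hd, h.trans ?_⟩
  rw [he, mul_sum]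
  refine sum_le_sum fun i _ => ?_
  split_ifs with hi
  · have : n * dens M = (∑ i, ∑ j, M i j) / n := by
      rw [_root_.dens]; field_simp
    simp only [univ_unique, mul_one, sum_const, card_singleton, one_smul, sum_sub_distrib,
      card_univ, Fintype.card_fin, nsmul_eq_mul]
    linarith
  · simp

/-- The column version of `exists_discX_of_heavy_rows`. -/
lemma exists_discX_of_heavy_cols {n : ℕ} (M : Matrix (Fin n) (Fin n) ℝ) (hn : 0 < n)
    (h : (∑ i, ∑ j, M i j) / 4 ≤
      ∑ j, if 2 * ((∑ i, ∑ j, M i j) / n) ≤ ∑ i, M i j then ∑ i, M i j else 0) :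
    ∃ X : Matrix (Fin n ⊕ Fin n) (Fin n ⊕ Fin n) ℝ, X.PosSemidef ∧ (∀ k, X k k ≤ 1) ∧
      (∑ i, ∑ j, M i j) / 4 ≤ discX M X := by
  have hn' : (0 : ℝ) < n := by exact_mod_cast hn
  obtain ⟨X, hX, hd, he⟩ := exists_gram_discX M (m := 1) (fun _ _ => 1)
    (fun j _ => if 2 * ((∑ i, ∑ j, M i j) / n) ≤ ∑ i, M i j then 1 else 0)
    (by simp) (by intro i; split_ifs <;> simp)
  refine ⟨X, hX, hd, h.trans ?_⟩
  rw [he, sum_comm (f := fun i j => (M i j - dens M) * _), mul_sum]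
  refine sum_le_sum fun j _ => ?_
  split_ifs with hj
  · have : n * dens M = (∑ i, ∑ j, M i j) / n := by
      rw [_root_.dens]; field_simp
    simp only [univ_unique, mul_one, sum_const, card_singleton, one_smul, sum_sub_distrib,
      card_univ, Fintype.card_fin, nsmul_eq_mul]
    linarith
  · simp

/-- Tangent-line bound for the convex function `q ↦ q ^ (-1/2)`. -/
lemma tangent_le_inv_sqrt {q t : ℝ} (hq : 0 < q) (ht : 0 ≤ t) :
    t / 2 * (3 - t ^ 2 * q) ≤ (√q)⁻¹ := by
  have hs : 0 < √q := Real.sqrt_pos.2 hq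
  rw [← one_div, le_div_iff₀ hs]
  nth_rewrite 1 [← Real.sq_sqrt hq.le]
  nlinarith [mul_nonneg (sq_nonneg (t * √q - 1)) (by positivity : 0 ≤ t * √q + 2)]

/-- The main case: most ones lie in rows and columns of less than twice the average degree `d`. -/
lemma exists_discX_of_light {n r : ℕ} (M : Matrix (Fin n) (Fin n) ℝ) (d t : ℝ)
    (hM : ∀ i j, M i j = 0 ∨ M i j = 1) (hrank : M.rank ≤ r) (hd : 0 < d) (ht : 0 ≤ t)
    (hS : ∑ i, ∑ j, M i j = d * n) (hp : dens M ≤ 1 / 2) (htr : t ^ 2 * (2 * r) = n)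
    (hrow : (∑ i, if 2 * d ≤ ∑ j, M i j then ∑ j, M i j else 0) ≤ d * n / 4)
    (hcol : (∑ j, if 2 * d ≤ ∑ i, M i j then ∑ i, M i j else 0) ≤ d * n / 4) :
    ∃ X : Matrix (Fin n ⊕ Fin n) (Fin n ⊕ Fin n) ℝ, X.PosSemidef ∧ (∀ k, X k k ≤ 1) ∧
      (√(2 * d))⁻¹ * (t / 2) * (d * n / 2) ≤ discX M X := by
  obtain ⟨C, D, hCD, hC, hD⟩ := exists_orthonormal_factorization M
  have hM0 : ∀ i j, 0 ≤ M i j := fun i j => by rcases hM i j with h | h <;> simp [h]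
  have hMsq : ∀ i j, M i j ^ 2 = M i j := fun i j => by rcases hM i j with h | h <;> simp [h]
  set a : Fin n → ℝ := fun i => if 2 * d ≤ ∑ j, M i j then 0 else 1 with ha
  set b : Fin n → ℝ := fun j => if 2 * d ≤ ∑ i, M i j then 0 else 1 with hb
  set q : Fin n → ℝ := fun j => ∑ k, D k j ^ 2 with hq
  have ha0 : ∀ i, 0 ≤ a i := fun i => by simp only [ha]; split_ifs <;> simp
  have ha1 : ∀ i, a i ≤ 1 := fun i => by simp only [ha]; split_ifs <;> simp
  have hb0 : ∀ j, 0 ≤ b j := fun j => by simp only [hb]; split_ifs <;> simp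
  have hb1 : ∀ j, b j ≤ 1 := fun j => by simp only [hb]; split_ifs <;> simp
  have hq0 : ∀ j, 0 ≤ q j := fun j => sum_nonneg fun k _ => sq_nonneg _
  have hqpos : ∀ i j, M i j = 1 → 0 < q j := by
    intro i j hij
    refine (hq0 j).lt_of_ne fun h0 => ?_
    have hz : ∀ k, D k j = 0 := fun k => by
      have := (sum_eq_zero_iff_of_nonneg (fun k _ => sq_nonneg (D k j))).1 h0.symm k (mem_univ k)
      exact pow_eq_zero_iff two_ne_zero |>.1 this
    have := hCD i j
    simp [hz, hij] at this
  have hs : 0 < √(2 * d) := Real.sqrt_pos.2 (by positivity)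
  have hU : ∀ i, ∑ k, ((√(2 * d))⁻¹ * a i * C i k) ^ 2 ≤ 1 := by
    intro i
    simp only [mul_pow, ← mul_sum, hC, hMsq]
    rw [inv_pow, Real.sq_sqrt (by positivity)]
    simp only [ha]
    split_ifs with h
    · simp
    · rw [one_pow, mul_one, inv_mul_le_iff₀ (by positivity)]
      linarith
  have hV : ∀ j, ∑ k, (b j * (√(q j))⁻¹ * D k j) ^ 2 ≤ 1 := by
    intro j
    simp only [mul_pow, ← mul_sum]
    rw [inv_pow, Real.sq_sqrt (hq0 j), mul_assoc]
    exact mul_le_one₀ (pow_le_one₀ (hb0 j) (hb1 j)) (mul_nonneg (inv_nonneg.2 (hq0 j)) (hq0 j))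
      inv_mul_le_one
  obtain ⟨X, hX, hdiag, he⟩ := exists_gram_discX M
    (fun i k => (√(2 * d))⁻¹ * a i * C i k) (fun j k => b j * (√(q j))⁻¹ * D k j) hU hV
  refine ⟨X, hX, hdiag, ?_⟩
  have hterm : ∀ i j, (√(2 * d))⁻¹ * (t / 2) *
        (3 * (a i * b j * M i j) - t ^ 2 * (q j * (b j * M i j))) ≤
      2 * ((M i j - dens M) * ∑ k, (√(2 * d))⁻¹ * a i * C i k * (b j * (√(q j))⁻¹ * D k j)) := by
    intro i j
    have hsum : ∑ k, (√(2 * d))⁻¹ * a i * C i k * (b j * (√(q j))⁻¹ * D k j)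
        = (√(2 * d))⁻¹ * a i * b j * (√(q j))⁻¹ * M i j := by
      rw [← hCD i j, mul_sum]
      exact sum_congr rfl fun k _ => by ring
    rw [hsum]
    rcases hM i j with h | h
    · simp [h]
    · have htan := tangent_le_inv_sqrt (hqpos i j h) ht
      rw [h]
      have hab : 0 ≤ (√(2 * d))⁻¹ * (a i * b j) :=
        mul_nonneg (inv_nonneg.2 hs.le) (mul_nonneg (ha0 i) (hb0 j))
      have hi : 0 ≤ (√(q j))⁻¹ := by positivity
      calc _ ≤ (√(2 * d))⁻¹ * (t / 2) * (3 * (a i * b j) - t ^ 2 * (q j * (a i * b j))) := by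
            have : a i * b j ≤ b j := mul_le_of_le_one_left (hb0 j) (ha1 i)
            rw [mul_one, mul_one]
            have := hq0 j
            gcongr
        _ = (√(2 * d))⁻¹ * (a i * b j) * (t / 2 * (3 - t ^ 2 * q j)) := by ring
        _ ≤ (√(2 * d))⁻¹ * (a i * b j) * (√(q j))⁻¹ := by gcongr
        _ ≤ (2 * (1 - dens M)) * ((√(2 * d))⁻¹ * (a i * b j) * (√(q j))⁻¹) :=
            le_mul_of_one_le_left (mul_nonneg hab hi) (by linarith)
        _ = _ := by ring
  have hlight : d * n / 2 ≤ ∑ i, ∑ j, a i * b j * M i j := by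
    have h1 : ∑ i, ∑ j, (1 - a i) * M i j ≤ d * n / 4 := by
      refine le_trans (le_of_eq (sum_congr rfl fun i _ => ?_)) hrow
      rw [← mul_sum]
      simp only [ha]
      split_ifs <;> simp
    have h2 : ∑ i, ∑ j, (1 - b j) * M i j ≤ d * n / 4 := by
      rw [sum_comm]
      refine le_trans (le_of_eq (sum_congr rfl fun j _ => ?_)) hcol
      rw [← mul_sum]
      simp only [hb]
      split_ifs <;> simp
    have h3 : ∑ i, ∑ j, (M i j - (1 - a i) * M i j - (1 - b j) * M i j)
        ≤ ∑ i, ∑ j, a i * b j * M i j := by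
      refine sum_le_sum fun i _ => sum_le_sum fun j _ => ?_
      nlinarith [mul_nonneg (mul_nonneg (sub_nonneg.2 (ha1 i)) (sub_nonneg.2 (hb1 j))) (hM0 i j)]
    simp only [sum_sub_distrib] at h3
    linarith
  have hweight : ∑ i, ∑ j, q j * (b j * M i j) ≤ 2 * d * r := by
    rw [sum_comm]
    calc _ ≤ ∑ j, q j * (2 * d) := by
          refine sum_le_sum fun j _ => ?_
          rw [← mul_sum, ← mul_sum]
          refine mul_le_mul_of_nonneg_left ?_ (hq0 j)
          simp only [hb]
          split_ifs with h
          · simp [hd.le]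
          · linarith
      _ = 2 * d * M.rank := by rw [← sum_mul, hD, mul_comm]
      _ ≤ 2 * d * r := by gcongr
  calc (√(2 * d))⁻¹ * (t / 2) * (d * n / 2)
      ≤ (√(2 * d))⁻¹ * (t / 2) * (3 * (∑ i, ∑ j, a i * b j * M i j)
          - t ^ 2 * ∑ i, ∑ j, q j * (b j * M i j)) := by
        refine mul_le_mul_of_nonneg_left ?_ (by positivity)
        have h1 := mul_le_mul_of_nonneg_left hweight (sq_nonneg t)
        have h2 : t ^ 2 * (2 * d * r) = d * n := by rw [← htr]; ring
        linarith
    _ = ∑ i, ∑ j, (√(2 * d))⁻¹ * (t / 2) *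
          (3 * (a i * b j * M i j) - t ^ 2 * (q j * (b j * M i j))) := by
        simp only [← mul_sum, sum_sub_distrib]
    _ ≤ discX M X := by
        rw [he, mul_sum]
        simp only [mul_sum (a := (2 : ℝ))]
        exact sum_le_sum fun i _ => sum_le_sum fun j _ => hterm i j

/-- There is `c > 0` so that every `n×n` binary matrix of rank at most `r` and average
degree `d ≤ n/2` has `pdisc(M) ≥ c·min{dn, d^{1/2}n^{3/2}/√r}`. -/
theorem stmt8 :
    ∃ c : ℝ, 0 < c ∧
      ∀ (n r : ℕ) (M : Matrix (Fin n) (Fin n) ℝ),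
        (∀ i j, M i j = 0 ∨ M i j = 1) →
        M.rank ≤ r →
        (∑ i, ∑ j, M i j) / n ≤ n / 2 →
        ∃ X : Matrix (Fin n ⊕ Fin n) (Fin n ⊕ Fin n) ℝ,
          X.PosSemidef ∧ (∀ k, X k k ≤ 1) ∧
          discX M X ≥ c * min (((∑ i, ∑ j, M i j) / n) * n)
            (Real.sqrt ((∑ i, ∑ j, M i j) / n) * (n : ℝ) * Real.sqrt n / Real.sqrt r) := by
  refine ⟨1 / 8, by norm_num, fun n r M hM hrank hdn => ?_⟩
  have hM0 : 0 ≤ ∑ i, ∑ j, M i j := sum_nonneg fun i _ => sum_nonneg fun j _ => by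
    rcases hM i j with h | h <;> simp [h]
  have htrivial : min (((∑ i, ∑ j, M i j) / n) * n)
      (√((∑ i, ∑ j, M i j) / n) * (n : ℝ) * √n / √r) ≤ 0 →
      ∃ X : Matrix (Fin n ⊕ Fin n) (Fin n ⊕ Fin n) ℝ, X.PosSemidef ∧ (∀ k, X k k ≤ 1) ∧
        discX M X ≥ 1 / 8 * min (((∑ i, ∑ j, M i j) / n) * n)
          (√((∑ i, ∑ j, M i j) / n) * (n : ℝ) * √n / √r) := by
    intro h
    refine ⟨0, Matrix.PosSemidef.zero, by simp, ?_⟩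
    simp only [discX, frob, Matrix.zero_apply, zero_mul, sum_const_zero, mul_zero, sub_zero]
    linarith
  rcases Nat.eq_zero_or_pos n with rfl | hn
  · exact htrivial (by simp)
  rcases Nat.eq_zero_or_pos r with rfl | hr
  · exact htrivial (by simp)
  have hn' : (0 : ℝ) < n := by exact_mod_cast hn
  have hr' : (0 : ℝ) < r := by exact_mod_cast hr
  rcases hM0.eq_or_lt with hS0 | hSpos
  · exact htrivial (by simp [← hS0])
  set d : ℝ := (∑ i, ∑ j, M i j) / n with hd
  have hS : ∑ i, ∑ j, M i j = d * n := by rw [hd]; field_simp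
  have hd0 : 0 < d := div_pos hSpos hn'
  by_cases hrow : (∑ i, ∑ j, M i j) / 4 ≤ ∑ i, if 2 * d ≤ ∑ j, M i j then ∑ j, M i j else 0
  · obtain ⟨X, hX, hdiag, hv⟩ := exists_discX_of_heavy_rows M hn hrow
    refine ⟨X, hX, hdiag, ?_⟩
    have := min_le_left (d * n) (√d * n * √n / √r)
    linarith
  by_cases hcol : (∑ i, ∑ j, M i j) / 4 ≤ ∑ j, if 2 * d ≤ ∑ i, M i j then ∑ i, M i j else 0
  · obtain ⟨X, hX, hdiag, hv⟩ := exists_discX_of_heavy_cols M hn hcol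
    refine ⟨X, hX, hdiag, ?_⟩
    have := min_le_left (d * n) (√d * n * √n / √r)
    linarith
  rw [hS] at hrow hcol
  have hp : dens M ≤ 1 / 2 := by
    rw [_root_.dens]
    rw [hS, mul_div_mul_right _ _ hn'.ne', div_le_iff₀ hn']
    linarith
  obtain ⟨X, hX, hdiag, hv⟩ := exists_discX_of_light (r := r) M d (√n / (√2 * √r)) hM hrank hd0
    (by positivity) hS hp
    (by rw [div_pow, mul_pow, Real.sq_sqrt hn'.le, Real.sq_sqrt zero_le_two, Real.sq_sqrt hr'.le]
        field_simp)
    (not_le.1 hrow).le (not_le.1 hcol).le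
  refine ⟨X, hX, hdiag, ?_⟩
  have hval : (√(2 * d))⁻¹ * (√n / (√2 * √r) / 2) * (d * n / 2) = 1 / 8 * (√d * n * √n / √r) := by
    have hsd : 0 < √d := Real.sqrt_pos.2 hd0
    have hsr : 0 < √(r : ℝ) := Real.sqrt_pos.2 hr'
    have h2 : √(2 : ℝ) ^ 2 = 2 := Real.sq_sqrt zero_le_two
    rw [Real.sqrt_mul zero_le_two]
    nth_rewrite 2 [← Real.sq_sqrt hd0.le]
    field_simp
    rw [h2]
    ring
  have := min_le_right (d * n) (√d * n * √n / √r)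
  linarith
end

section
/- There exists a constant c > 0 such that every M ∈ {0,1}^{n×n} with rank(M) ≤ r and density p(M) ≤ 1/2 contains an all-zero submatrix with at least n/2^{c√r} rows and n/2^{c√r} columns. -/
open Finset

/-- The Rademacher sign attached to a bit. -/
def boolSign (b : Bool) : ℝ := if b then 1 else -1

lemma boolSign_not (b : Bool) : boolSign (!b) = -boolSign b := by
  cases b <;> simp [boolSign]

lemma boolSign_sq (b : Bool) : boolSign b ^ 2 = 1 := by
  cases b <;> simp [boolSign]

/-- The Rademacher sum `∑ k ∈ s, ±x k`. -/
def radSum {d : Type} (x : d → ℝ) (s : Finset d) (ω : d → Bool) : ℝ :=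
  ∑ k ∈ s, x k * boolSign (ω k)

lemma sum_mul_boolSign_eq_zero {d : Type} [Fintype d] [DecidableEq d] (k : d)
    (F : (d → Bool) → ℝ) (hF : ∀ ω b, F (Function.update ω k b) = F ω) :
    ∑ ω, F ω * boolSign (ω k) = 0 := by
  have hinv : Function.Involutive (fun ω : d → Bool => Function.update ω k (!ω k)) := by
    intro ω
    simp
  set σ := Function.Involutive.toPerm _ hinv with hσ
  have h := Equiv.sum_comp σ (fun ω => F ω * boolSign (ω k))
  have h2 : ∀ ω, F (σ ω) * boolSign (σ ω k) = -(F ω * boolSign (ω k)) := by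
    intro ω
    simp [hσ, Function.Involutive.toPerm, hF, boolSign_not]
  rw [sum_congr rfl fun ω _ => h2 ω, sum_neg_distrib] at h
  linarith

lemma radSum_update {d : Type} [DecidableEq d] (x : d → ℝ) {s : Finset d} {k : d} (hk : k ∉ s)
    (ω : d → Bool) (b : Bool) : radSum x s (Function.update ω k b) = radSum x s ω := by
  refine sum_congr rfl fun l hl => ?_
  rw [Function.update_of_ne]
  rintro rfl
  exact hk hl

lemma radSum_insert {d : Type} [DecidableEq d] (x : d → ℝ) {s : Finset d} {k : d} (hk : k ∉ s)
    (ω : d → Bool) : radSum x (insert k s) ω = x k * boolSign (ω k) + radSum x s ω :=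
  sum_insert hk

lemma sum_radSum_sq {d : Type} [Fintype d] [DecidableEq d] (x : d → ℝ) (s : Finset d) :
    ∑ ω, radSum x s ω ^ 2 = Fintype.card (d → Bool) * ∑ k ∈ s, x k ^ 2 := by
  induction s using Finset.induction_on with
  | empty => simp [radSum]
  | insert k s hk ih =>
    have h0 := sum_mul_boolSign_eq_zero k (fun ω => 2 * x k * radSum x s ω)
      (fun ω b => by rw [radSum_update x hk])
    have h1 : ∀ ω, radSum x (insert k s) ω ^ 2
        = x k ^ 2 + 2 * x k * radSum x s ω * boolSign (ω k) + radSum x s ω ^ 2 := by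
      intro ω
      rw [radSum_insert x hk]
      linear_combination x k ^ 2 * boolSign_sq (ω k)
    rw [sum_congr rfl fun ω _ => h1 ω, sum_add_distrib, sum_add_distrib, h0, ih, sum_insert hk]
    simp
    ring

lemma sum_radSum_mul {d : Type} [Fintype d] [DecidableEq d] (x y : d → ℝ) :
    ∑ ω, radSum x univ ω * radSum y univ ω = Fintype.card (d → Bool) * ∑ k, x k * y k := by
  have h1 := sum_radSum_sq (fun k => x k + y k) univ
  have h2 := sum_radSum_sq (fun k => x k - y k) univ
  have e1 : ∀ ω, radSum (fun k => x k + y k) univ ω = radSum x univ ω + radSum y univ ω := by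
    intro ω; simp [radSum, add_mul, sum_add_distrib]
  have e2 : ∀ ω, radSum (fun k => x k - y k) univ ω = radSum x univ ω - radSum y univ ω := by
    intro ω; simp [radSum, sub_mul, sum_sub_distrib]
  simp only [e1, e2, add_sq, sub_sq, sum_add_distrib, sum_sub_distrib] at h1 h2
  simp only [mul_assoc, ← mul_sum] at h1 h2
  linarith

lemma sum_radSum_pow_four_le {d : Type} [Fintype d] [DecidableEq d] (x : d → ℝ) (s : Finset d) :
    ∑ ω, radSum x s ω ^ 4 ≤ Fintype.card (d → Bool) * (3 * (∑ k ∈ s, x k ^ 2) ^ 2) := by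
  induction s using Finset.induction_on with
  | empty => simp [radSum]
  | insert k s hk ih =>
    have h0 := sum_mul_boolSign_eq_zero k
      (fun ω => 4 * x k ^ 3 * radSum x s ω + 4 * x k * radSum x s ω ^ 3)
      (fun ω b => by rw [radSum_update x hk])
    have h1 : ∀ ω, radSum x (insert k s) ω ^ 4
        = x k ^ 4 + (4 * x k ^ 3 * radSum x s ω + 4 * x k * radSum x s ω ^ 3) * boolSign (ω k)
          + 6 * x k ^ 2 * radSum x s ω ^ 2 + radSum x s ω ^ 4 := by
      intro ω
      rw [radSum_insert x hk]
      linear_combination (x k ^ 4 * (boolSign (ω k) ^ 2 + 1) +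
        4 * x k ^ 3 * radSum x s ω * boolSign (ω k)
        + 6 * x k ^ 2 * radSum x s ω ^ 2) * boolSign_sq (ω k)
    rw [sum_congr rfl fun ω _ => h1 ω, sum_add_distrib, sum_add_distrib, sum_add_distrib, h0,
      ← mul_sum, sum_radSum_sq, sum_insert hk]
    simp only [sum_const, card_univ, nsmul_eq_mul]
    have : 0 ≤ (Fintype.card (d → Bool) : ℝ) * x k ^ 4 := by positivity
    nlinarith

/-- Truncation of a real number to `0` outside `[-7, 7]`. -/
noncomputable def trunc (t : ℝ) : ℝ := if |t| ≤ 7 then t else 0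

lemma abs_trunc_le (t : ℝ) : |trunc t| ≤ 7 := by
  unfold trunc
  split_ifs with h
  · exact h
  · simp

lemma trunc_sq_le (t : ℝ) : trunc t ^ 2 ≤ t ^ 2 := by
  unfold trunc
  split_ifs with h
  · rfl
  · simpa using sq_nonneg t

lemma sub_trunc_sq_le (t : ℝ) : 49 * (t - trunc t) ^ 2 ≤ t ^ 4 := by
  unfold trunc
  split_ifs with h
  · simp; positivity
  · have : (7 : ℝ) ^ 2 ≤ |t| ^ 2 := by
      gcongr
      linarith
    rw [sq_abs] at this
    nlinarith [sq_nonneg t]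

lemma abs_sum_mul_le {ι : Type} [Fintype ι] (c f : ι → ℝ) (D T : ℝ)
    (hD : ∀ X : Finset ι, |∑ i ∈ X, c i| ≤ D) (hf : ∀ i, |f i| ≤ T) (hT : 0 ≤ T) :
    |∑ i, f i * c i| ≤ 2 * T * D := by
  classical
  have h1 : |∑ i, f i * c i| ≤ ∑ i, T * |c i| := by
    refine (abs_sum_le_sum_abs _ _).trans (sum_le_sum fun i _ => ?_)
    rw [abs_mul]
    exact mul_le_mul_of_nonneg_right (hf i) (abs_nonneg _)
  have h2 : ∑ i, |c i| ≤ 2 * D := by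
    rw [← sum_filter_add_sum_filter_not univ (fun i => 0 ≤ c i) (fun i => |c i|)]
    have a1 : ∑ i with 0 ≤ c i, |c i| ≤ D := by
      refine le_trans (le_of_eq (sum_congr rfl fun i hi => ?_)) ((le_abs_self _).trans (hD _))
      exact abs_of_nonneg (mem_filter.1 hi).2
    have a2 : ∑ i with ¬ 0 ≤ c i, |c i| ≤ D := by
      refine le_trans (le_of_eq ?_) ((neg_le_abs _).trans (hD (univ.filter fun i => ¬ 0 ≤ c i)))
      rw [← sum_neg_distrib]
      exact sum_congr rfl fun i hi => abs_of_neg (not_le.1 (mem_filter.1 hi).2)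
    linarith
  rw [← mul_sum] at h1
  nlinarith

lemma sum_sum_mul_le {ι κ : Type} [Fintype ι] [Fintype κ] (A : ι → κ → ℝ) (D T : ℝ)
    (hD : ∀ (X : Finset ι) (Y : Finset κ), |∑ i ∈ X, ∑ j ∈ Y, A i j| ≤ D) (hT : 0 ≤ T)
    (f : ι → ℝ) (g : κ → ℝ) (hf : ∀ i, |f i| ≤ T) (hg : ∀ j, |g j| ≤ T) :
    ∑ i, ∑ j, A i j * (f i * g j) ≤ 4 * T ^ 2 * D := by
  have h1 : ∀ X : Finset ι, |∑ i ∈ X, ∑ j, g j * A i j| ≤ 2 * T * D := by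
    intro X
    rw [sum_comm]
    simp only [← mul_sum]
    refine abs_sum_mul_le _ g D T (fun Y => ?_) hg hT
    rw [sum_comm]
    exact hD X Y
  have h2 := (le_abs_self _).trans (abs_sum_mul_le _ f _ T h1 hf hT)
  have e : ∑ i, ∑ j, A i j * (f i * g j) = ∑ i, f i * ∑ j, g j * A i j := by
    simp only [mul_sum]
    exact sum_congr rfl fun i _ => sum_congr rfl fun j _ => by ring
  rw [e]
  linarith

/-- A **Grothendieck-type inequality**: if all rectangle sums of `A` are bounded by `D`, then so is,
up to a constant, `∑ A i j ⟪x i, y j⟫` for vectors `x i`, `y j` in the unit ball. -/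
theorem sum_mul_inner_le_of_rectangle_sums_le {ι κ : Type} [Fintype ι] [Fintype κ]
    (A : ι → κ → ℝ) (D : ℝ)
    (hD : ∀ (X : Finset ι) (Y : Finset κ), |∑ i ∈ X, ∑ j ∈ Y, A i j| ≤ D)
    {d : Type} [Fintype d] (x : ι → d → ℝ) (y : κ → d → ℝ)
    (hx : ∀ i, ∑ k, x i k ^ 2 ≤ 1) (hy : ∀ j, ∑ k, y j k ^ 2 ≤ 1) :
    ∑ i, ∑ j, A i j * ∑ k, x i k * y j k ≤ 392 * D := by
  classical
  let S : Set ℝ := {v | ∃ (d : Type) (_ : Fintype d) (B : ℝ) (x : ι → d → ℝ) (y : κ → d → ℝ),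
    0 < B ∧ (∀ i, ∑ k, x i k ^ 2 ≤ B) ∧ (∀ j, ∑ k, y j k ^ 2 ≤ B) ∧
    ∑ i, ∑ j, A i j * ∑ k, x i k * y j k = v * B}
  have hbdd : BddAbove S := by
    refine ⟨∑ i, ∑ j, |A i j|, ?_⟩
    rintro v ⟨d, _, B, x, y, hB, hx, hy, hv⟩
    refine le_of_mul_le_mul_right ?_ hB
    rw [← hv, sum_mul]
    refine sum_le_sum fun i _ => ?_
    rw [sum_mul]
    refine sum_le_sum fun j _ => ?_
    refine (le_abs_self _).trans ?_
    rw [abs_mul]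
    refine mul_le_mul_of_nonneg_left ?_ (abs_nonneg _)
    refine abs_le_of_sq_le_sq ?_ hB.le
    refine (sum_mul_sq_le_sq_mul_sq _ _ _).trans ?_
    rw [sq B]
    exact mul_le_mul (hx i) (hy j) (sum_nonneg fun _ _ => sq_nonneg _) hB.le
  have hle : ∀ (d : Type) [Fintype d] (B : ℝ) (x : ι → d → ℝ) (y : κ → d → ℝ), 0 < B →
      (∀ i, ∑ k, x i k ^ 2 ≤ B) → (∀ j, ∑ k, y j k ^ 2 ≤ B) →
      ∑ i, ∑ j, A i j * ∑ k, x i k * y j k ≤ sSup S * B := by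
    intro d _ B x y hB hx hy
    rw [← div_le_iff₀ hB]
    exact le_csSup hbdd ⟨d, _, B, x, y, hB, hx, hy, by field_simp⟩
  have hunit : ∀ (d : Type) [Fintype d] (x : ι → d → ℝ) (y : κ → d → ℝ),
      (∀ i, ∑ k, x i k ^ 2 ≤ 1) → (∀ j, ∑ k, y j k ^ 2 ≤ 1) →
      ∑ i, ∑ j, A i j * ∑ k, x i k * y j k ≤ 196 * D + sSup S / 2 := by
    intro d _ x y hx hy
    set N : ℝ := ((Fintype.card (d → Bool) : ℕ) : ℝ) with hN
    have hNpos : 0 < N := by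
      rw [hN]
      exact_mod_cast Fintype.card_pos
    let p : ι → (d → Bool) → ℝ := fun i => radSum (x i) univ
    let q : κ → (d → Bool) → ℝ := fun j => radSum (y j) univ
    have sq_le : ∀ z : d → ℝ, ∑ k, z k ^ 2 ≤ 1 → ∑ ω, radSum z univ ω ^ 2 ≤ N := by
      intro z hz
      rw [sum_radSum_sq]
      exact mul_le_of_le_one_right hNpos.le hz
    have trunc_le : ∀ z : d → ℝ, ∑ k, z k ^ 2 ≤ 1 →
        ∑ ω, trunc (radSum z univ ω) ^ 2 ≤ N := fun z hz =>
      (sum_le_sum fun ω _ => trunc_sq_le _).trans (sq_le z hz)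
    have tail_le : ∀ z : d → ℝ, ∑ k, z k ^ 2 ≤ 1 →
        ∑ ω, (4 * (radSum z univ ω - trunc (radSum z univ ω))) ^ 2 ≤ N := by
      intro z hz
      have h4 := sum_radSum_pow_four_le z univ
      have h0 : 0 ≤ ∑ k, z k ^ 2 := sum_nonneg fun _ _ => sq_nonneg _
      have h1 : N * (3 * (∑ k, z k ^ 2) ^ 2) ≤ N * (3 * 1) := by
        gcongr
        exact pow_le_one₀ h0 hz
      have h2 : 49 * ∑ ω, (radSum z univ ω - trunc (radSum z univ ω)) ^ 2
          ≤ ∑ ω, radSum z univ ω ^ 4 := by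
        rw [mul_sum]
        exact sum_le_sum fun ω _ => sub_trunc_sq_le _
      simp only [mul_pow, ← mul_sum]
      linarith
    have main : ∑ i, ∑ j, A i j * ∑ ω, trunc (p i ω) * trunc (q j ω) ≤ N * (196 * D) := by
      have e : ∑ i, ∑ j, A i j * ∑ ω, trunc (p i ω) * trunc (q j ω)
          = ∑ ω, ∑ i, ∑ j, A i j * (trunc (p i ω) * trunc (q j ω)) := by
        simp only [mul_sum]
        rw [sum_comm (s := (univ : Finset (d → Bool)))]
        exact sum_congr rfl fun i _ => sum_comm
      rw [e]
      have : ∀ ω ∈ (univ : Finset (d → Bool)),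
          ∑ i, ∑ j, A i j * (trunc (p i ω) * trunc (q j ω)) ≤ 196 * D := fun ω _ =>
        (sum_sum_mul_le A D 7 hD (by norm_num) _ _ (fun i => abs_trunc_le _)
          (fun j => abs_trunc_le _)).trans (by linarith)
      refine (sum_le_sum this).trans ?_
      simp [hN]
    have tail₁ := hle _ N (fun i ω => 4 * (p i ω - trunc (p i ω))) q hNpos
      (fun i => tail_le _ (hx i)) (fun j => sq_le _ (hy j))
    have tail₂ := hle _ N (fun i ω => trunc (p i ω)) (fun j ω => 4 * (q j ω - trunc (q j ω))) hNpos
      (fun i => trunc_le _ (hx i)) (fun j => tail_le _ (hy j))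
    have split : N * ∑ i, ∑ j, A i j * ∑ k, x i k * y j k
        = ∑ i, ∑ j, A i j * ∑ ω, trunc (p i ω) * trunc (q j ω)
          + (1 / 4) * ∑ i, ∑ j, A i j * ∑ ω, 4 * (p i ω - trunc (p i ω)) * q j ω
          + (1 / 4) * ∑ i, ∑ j, A i j * ∑ ω, trunc (p i ω) * (4 * (q j ω - trunc (q j ω))) := by
      simp only [mul_sum (s := (univ : Finset ι)), ← sum_add_distrib]
      refine sum_congr rfl fun i _ => ?_
      simp only [mul_sum (s := (univ : Finset κ)), ← sum_add_distrib]
      refine sum_congr rfl fun j _ => ?_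
      have := sum_radSum_mul (x i) (y j)
      calc N * (A i j * ∑ k, x i k * y j k) = A i j * ∑ ω, p i ω * q j ω := by
            rw [this]; ring
        _ = _ := by
            simp only [mul_sum, ← sum_add_distrib]
            exact sum_congr rfl fun ω _ => by ring
    refine le_of_mul_le_mul_left ?_ hNpos
    rw [split]
    linarith
  have hhalf : ∀ v ∈ S, v ≤ 196 * D + sSup S / 2 := by
    rintro v ⟨d, _, B, x, y, hB, hx, hy, hv⟩
    have hs : 0 < √B := Real.sqrt_pos.2 hB
    have hss : √B ^ 2 = B := Real.sq_sqrt hB.le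
    have h := hunit d (fun i k => x i k / √B) (fun j k => y j k / √B)
      (fun i => by
        simp only [div_pow, ← sum_div, hss]
        exact (div_le_one hB).2 (hx i))
      (fun j => by
        simp only [div_pow, ← sum_div, hss]
        exact (div_le_one hB).2 (hy j))
    have e : ∀ a b : ℝ, a / √B * (b / √B) = a * b / B := by
      intro a b
      rw [div_mul_div_comm, ← sq, hss]
    simp only [e, ← sum_div, mul_div_assoc'] at h
    rwa [hv, mul_div_cancel_right₀ _ hB.ne'] at h
  have h1 : sSup S ≤ 196 * D + sSup S / 2 := by
    refine csSup_le ?_ hhalf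
    exact ⟨_, d, _, 1, x, y, one_pos, hx, hy, (mul_one _).symm⟩
  have h2 := hle d 1 x y one_pos hx hy
  linarith
lemma exists_vectors_sum_mul_inner_ge {ι κ : Type} [Fintype ι] [Fintype κ] (A : Matrix ι κ ℝ)
    {R t : ℝ} (hR : (A.rank : ℝ) ≤ R) (ht : 0 ≤ t) (htR : t ^ 2 * R ≤ ∑ i, ∑ j, A i j ^ 2) :
    ∃ (x : ι → κ → ℝ) (y : κ → κ → ℝ),
      (∀ i, ∑ k, x i k ^ 2 = ∑ j, A i j ^ 2) ∧ (∀ j, ∑ k, y j k ^ 2 = ∑ i, A i j ^ 2) ∧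
      t * ∑ i, ∑ j, A i j ^ 2 ≤ ∑ i, ∑ j, A i j * ∑ k, x i k * y j k := by
  classical
  have hP : (A.transpose * A).PosSemidef := by
    simpa using Matrix.posSemidef_conjTranspose_mul_self A
  have hH := hP.isHermitian
  set U : Matrix κ κ ℝ := (hH.eigenvectorUnitary : Matrix κ κ ℝ) with hU
  set l := hH.eigenvalues with hl
  have l0 : ∀ k, 0 ≤ l k := hP.eigenvalues_nonneg
  have hUU : U.transpose * U = 1 := by
    simpa [Matrix.star_eq_conjTranspose] using Unitary.coe_star_mul_self hH.eigenvectorUnitary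
  have hUU' : U * U.transpose = 1 := by
    simpa [Matrix.star_eq_conjTranspose] using Unitary.coe_mul_star_self hH.eigenvectorUnitary
  have hspec : A.transpose * A = U * Matrix.diagonal l * U.transpose := by
    have := hH.spectral_theorem
    rw [Unitary.conjStarAlgAut_apply] at this
    simpa [Matrix.star_eq_conjTranspose] using this
  have hdiag : (A * U).transpose * (A * U) = Matrix.diagonal l := by
    rw [Matrix.transpose_mul, Matrix.mul_assoc, ← Matrix.mul_assoc A.transpose, hspec]
    simp only [Matrix.mul_assoc, hUU, Matrix.mul_one]
    rw [← Matrix.mul_assoc, hUU, Matrix.one_mul]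
  have hF : ∑ i, ∑ j, A i j ^ 2 = ∑ k, l k := by
    have h := hH.trace_eq_sum_eigenvalues
    simp only [Matrix.trace, Matrix.diag, Matrix.mul_apply, Matrix.transpose_apply] at h
    rw [sum_comm]
    simpa [sq] using h
  have hcard : (#{k | l k ≠ 0} : ℝ) ≤ R := by
    refine le_trans (le_of_eq ?_) hR
    rw [← Matrix.rank_transpose_mul_self, hH.rank_eq_card_non_zero_eigs, Fintype.card_subtype]
  refine ⟨A * U, fun j k => √(l k) * U j k, fun i => ?_, fun j => ?_, ?_⟩
  · have h : (A * U) * (A * U).transpose = A * A.transpose := by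
      rw [Matrix.transpose_mul, Matrix.mul_assoc, ← Matrix.mul_assoc U, hUU', Matrix.one_mul]
    have := congrFun (congrFun h i) i
    rw [Matrix.mul_apply, Matrix.mul_apply] at this
    simp only [Matrix.transpose_apply] at this
    simpa only [sq] using this
  · have := congrFun (congrFun hspec j) j
    rw [Matrix.mul_apply, Matrix.mul_apply] at this
    simp only [Matrix.mul_diagonal, Matrix.transpose_apply] at this
    simp only [sq]
    rw [this]
    refine sum_congr rfl fun k _ => ?_
    have := Real.mul_self_sqrt (l0 k)
    linear_combination U j k ^ 2 * this
  · have e : ∑ i, ∑ j, A i j * ∑ k, (A * U) i k * (√(l k) * U j k) = ∑ k, √(l k) * l k := by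
      have h1 : ∀ k, l k = ∑ i, (A * U) i k * (A * U) i k := by
        intro k
        have := congrFun (congrFun hdiag k) k
        rw [Matrix.mul_apply] at this
        simpa using this.symm
      calc _ = ∑ i, ∑ k, √(l k) * ((A * U) i k * ∑ j, A i j * U j k) := by
            refine sum_congr rfl fun i _ => ?_
            simp only [mul_sum]
            rw [sum_comm]
            exact sum_congr rfl fun k _ => sum_congr rfl fun j _ => by ring
        _ = ∑ k, √(l k) * ∑ i, (A * U) i k * (A * U) i k := by
            rw [sum_comm]
            simp only [mul_sum, Matrix.mul_apply]
        _ = _ := sum_congr rfl fun k _ => by rw [← h1]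
    rw [e, hF]
    have tangent : ∀ k, 3 / 2 * t * l k - (if l k ≠ 0 then t ^ 3 / 2 else 0) ≤ √(l k) * l k := by
      intro k
      split_ifs with h
      · have h1 := Real.mul_self_sqrt (l0 k)
        have h2 := Real.sqrt_nonneg (l k)
        set s := √(l k)
        rw [← h1]
        nlinarith [mul_nonneg (sq_nonneg (s - t)) (by linarith : 0 ≤ s + t / 2)]
      · simp [not_not.1 h]
    have hsum := sum_le_sum fun k (_ : k ∈ univ) => tangent k
    rw [sum_sub_distrib, ← mul_sum, ← sum_filter, sum_const, nsmul_eq_mul] at hsum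
    have h3 : (#{k | l k ≠ 0} : ℝ) * (t ^ 3 / 2) ≤ R * (t ^ 3 / 2) := by gcongr
    rw [hF] at htR
    nlinarith [mul_le_mul_of_nonneg_left htR ht]

/-- A low-rank matrix with short rows and columns but large Frobenius norm has a rectangle with
large sum. -/
theorem mul_frobenius_le_of_rectangle_sums_le {ι κ : Type} [Fintype ι] [Fintype κ]
    (A : Matrix ι κ ℝ) {R t a b D : ℝ} (hR : (A.rank : ℝ) ≤ R) (ht : 0 ≤ t)
    (htR : t ^ 2 * R ≤ ∑ i, ∑ j, A i j ^ 2) (ha : 0 < a) (hb : 0 < b)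
    (hrow : ∀ i, ∑ j, A i j ^ 2 ≤ a) (hcol : ∀ j, ∑ i, A i j ^ 2 ≤ b)
    (hD : ∀ (X : Finset ι) (Y : Finset κ), |∑ i ∈ X, ∑ j ∈ Y, A i j| ≤ D) :
    t * ∑ i, ∑ j, A i j ^ 2 ≤ √(a * b) * (392 * D) := by
  obtain ⟨x, y, hx, hy, hxy⟩ := exists_vectors_sum_mul_inner_ge A hR ht htR
  have h := sum_mul_inner_le_of_rectangle_sums_le A D hD
    (fun i k => x i k / √a) (fun j k => y j k / √b)
    (fun i => by
      simp only [div_pow, ← sum_div, Real.sq_sqrt ha.le]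
      exact (div_le_one ha).2 (hx i ▸ hrow i))
    (fun j => by
      simp only [div_pow, ← sum_div, Real.sq_sqrt hb.le]
      exact (div_le_one hb).2 (hy j ▸ hcol j))
  have e : ∀ p q : ℝ, p / √a * (q / √b) = p * q / √(a * b) := by
    intro p q
    rw [div_mul_div_comm, ← Real.sqrt_mul ha.le]
  simp only [e, ← sum_div, mul_div_assoc'] at h
  rw [div_le_iff₀ (Real.sqrt_pos.2 (mul_pos ha hb))] at h
  linarith
lemma Matrix.rank_add_le_add_rank {ι κ : Type} [Fintype ι] [Fintype κ] (A B : Matrix ι κ ℝ) :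
    (A + B).rank ≤ A.rank + B.rank := by
  unfold Matrix.rank
  refine le_trans (Submodule.finrank_mono ?_)
    (Submodule.finrank_add_le_finrank_add_finrank A.mulVecLin.range B.mulVecLin.range)
  rintro _ ⟨v, rfl⟩
  rw [Matrix.mulVecLin_add]
  exact Submodule.add_mem_sup ⟨v, rfl⟩ ⟨v, rfl⟩

/-- The matrix `M - p` with all entries outside `X × Y` replaced by `0`. -/
noncomputable def maskedShift {ι κ : Type} [DecidableEq ι] [DecidableEq κ] (M : Matrix ι κ ℝ)
    (p : ℝ) (X : Finset ι) (Y : Finset κ) : Matrix ι κ ℝ :=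
  Matrix.of fun i j => if i ∈ X then if j ∈ Y then M i j - p else 0 else 0

lemma rank_maskedShift_le {ι κ : Type} [Fintype ι] [Fintype κ] [DecidableEq ι] [DecidableEq κ]
    (M : Matrix ι κ ℝ) (p : ℝ) (X : Finset ι) (Y : Finset κ) :
    (maskedShift M p X Y).rank ≤ M.rank + 1 := by
  have e : maskedShift M p X Y = Matrix.diagonal (fun i => if i ∈ X then (1 : ℝ) else 0) *
      (M + Matrix.vecMulVec (fun _ => -p) (fun _ => 1)) *
      Matrix.diagonal (fun j => if j ∈ Y then (1 : ℝ) else 0) := by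
    ext i j
    rw [Matrix.mul_diagonal, Matrix.diagonal_mul]
    simp only [maskedShift, Matrix.of_apply, Matrix.add_apply, Matrix.vecMulVec_apply]
    split_ifs <;> simp [sub_eq_add_neg]
  rw [e]
  refine (Matrix.rank_mul_le_left _ _).trans ((Matrix.rank_mul_le_right _ _).trans ?_)
  refine (Matrix.rank_add_le_add_rank _ _).trans ?_
  gcongr
  exact Matrix.rank_vecMulVec_le _ _

lemma sum_sum_maskedShift {ι κ : Type} [DecidableEq ι] [DecidableEq κ]
    (M : Matrix ι κ ℝ) (p : ℝ) (X X' : Finset ι) (Y Y' : Finset κ) :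
    ∑ i ∈ X', ∑ j ∈ Y', maskedShift M p X Y i j = ∑ i ∈ X' ∩ X, ∑ j ∈ Y' ∩ Y, (M i j - p) := by
  simp only [maskedShift, Matrix.of_apply, ← sum_ite_mem]
  refine sum_congr rfl fun i _ => ?_
  split_ifs <;> simp

lemma sum_maskedShift_sq_row_le {ι κ : Type} [Fintype κ] [DecidableEq ι] [DecidableEq κ]
    {M : Matrix ι κ ℝ} (hM : ∀ i j, M i j = 0 ∨ M i j = 1) {p q : ℝ}
    (hp : 0 ≤ p) (hp2 : p ≤ 1 / 2) (X : Finset ι) (Y : Finset κ)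
    (hq : ∀ i ∈ X, ∑ j ∈ Y, M i j ≤ q) (hpq : 0 ≤ q) (i : ι) :
    ∑ j, maskedShift M p X Y i j ^ 2 ≤ q + p * #Y := by
  have hnn : 0 ≤ q + p * #Y := by positivity
  by_cases hi : i ∈ X
  · have h1 : ∑ j, maskedShift M p X Y i j ^ 2 = ∑ j ∈ Y, (M i j - p) ^ 2 := by
      simp [maskedShift, hi, ite_pow, sum_ite_mem]
    have h2 : ∑ j ∈ Y, (M i j - p) ^ 2 ≤ ∑ j ∈ Y, (M i j + p) := by
      refine sum_le_sum fun j _ => ?_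
      rcases hM i j with h | h <;> rw [h] <;> nlinarith
    rw [h1]
    refine h2.trans ?_
    rw [sum_add_distrib, sum_const, nsmul_eq_mul]
    linarith [hq i hi]
  · simpa [maskedShift, hi] using hnn

lemma maskedShift_transpose {ι κ : Type} [DecidableEq ι] [DecidableEq κ]
    (M : Matrix ι κ ℝ) (p : ℝ) (X : Finset ι) (Y : Finset κ) :
    (maskedShift M p X Y).transpose = maskedShift M.transpose p Y X := by
  ext i j
  simp only [maskedShift, Matrix.of_apply, Matrix.transpose_apply]
  split_ifs <;> rfl

lemma sum_sum_sub_eq {ι κ : Type} (M : Matrix ι κ ℝ) (p : ℝ) (X : Finset ι) (Y : Finset κ) :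
    ∑ i ∈ X, ∑ j ∈ Y, (M i j - p) = ∑ i ∈ X, ∑ j ∈ Y, M i j - p * (#X * #Y) := by
  simp only [sum_sub_distrib, sum_const, nsmul_eq_mul]
  ring

lemma sum_sum_maskedShift_sq {ι κ : Type} [Fintype ι] [Fintype κ] [DecidableEq ι] [DecidableEq κ]
    {M : Matrix ι κ ℝ} (hM : ∀ i j, M i j = 0 ∨ M i j = 1) {p : ℝ}
    (X : Finset ι) (Y : Finset κ) (hsum : ∑ i ∈ X, ∑ j ∈ Y, M i j = p * (#X * #Y)) :
    ∑ i, ∑ j, maskedShift M p X Y i j ^ 2 = p * (1 - p) * (#X * #Y) := by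
  have h1 : ∑ i, ∑ j, maskedShift M p X Y i j ^ 2 = ∑ i ∈ X, ∑ j ∈ Y, (M i j - p) ^ 2 := by
    rw [← sum_filter_add_sum_filter_not univ (· ∈ X)]
    have z : ∑ i with i ∉ X, ∑ j, maskedShift M p X Y i j ^ 2 = 0 := by
      refine sum_eq_zero fun i hi => ?_
      simp [maskedShift, (mem_filter.1 hi).2]
    rw [z, add_zero, filter_mem_eq_inter, univ_inter]
    refine sum_congr rfl fun i hi => ?_
    simp [maskedShift, hi, ite_pow, sum_ite_mem]
  have h2 : ∑ i ∈ X, ∑ j ∈ Y, (M i j - p) ^ 2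
      = (1 - 2 * p) * ∑ i ∈ X, ∑ j ∈ Y, M i j + p ^ 2 * (#X * #Y) := by
    have : ∀ i j, (M i j - p) ^ 2 = (1 - 2 * p) * M i j + p ^ 2 := by
      intro i j
      rcases hM i j with h | h <;> rw [h] <;> ring
    simp only [this, sum_add_distrib, ← mul_sum, sum_const, nsmul_eq_mul]
    ring
  rw [h1, h2, hsum]
  ring

/-- A regular low-rank Boolean matrix has a rectangle on which the density is significantly
lower than average. -/
theorem exists_rectangle_sum_sub_le {ι κ : Type} [Fintype ι] [Fintype κ]
    [DecidableEq ι] [DecidableEq κ]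
    {M : Matrix ι κ ℝ} (hM : ∀ i j, M i j = 0 ∨ M i j = 1)
    {r : ℕ} (hr : 1 ≤ r) (hrank : M.rank ≤ r) {p : ℝ} (hp : 0 < p) (hp2 : p ≤ 1 / 2)
    {X : Finset ι} {Y : Finset κ} (hX : X.Nonempty) (hY : Y.Nonempty)
    (hsum : ∑ i ∈ X, ∑ j ∈ Y, M i j = p * (#X * #Y))
    (hrow : ∀ i ∈ X, ∑ j ∈ Y, M i j ≤ 8 * p * #Y)
    (hcol : ∀ j ∈ Y, ∑ i ∈ X, M i j ≤ 8 * p * #X) :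
    ∃ X' ⊆ X, ∃ Y' ⊆ Y,
      ∑ i ∈ X', ∑ j ∈ Y', (M i j - p) ≤ -(1 / 30000 * √(p / r) * (#X * #Y)) := by
  by_contra! hcon
  set δ : ℝ := 1 / 30000 * √(p / r) * (#X * #Y) with hδ
  have hXpos : (0 : ℝ) < #X := by exact_mod_cast hX.card_pos
  have hYpos : (0 : ℝ) < #Y := by exact_mod_cast hY.card_pos
  have hrpos : (0 : ℝ) < r := by exact_mod_cast hr
  have htot : ∑ i ∈ X, ∑ j ∈ Y, (M i j - p) = 0 := by
    rw [sum_sum_sub_eq, hsum, sub_self]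
  have hδ0 : 0 ≤ δ := by positivity
  have hsub : ∀ X' ⊆ X, ∀ Y' ⊆ Y, |∑ i ∈ X', ∑ j ∈ Y', (M i j - p)| ≤ 2 * δ := by
    intro X' hX' Y' hY'
    have h1 := hcon X' hX' Y' hY'
    have h2 := hcon (X \ X') sdiff_subset Y' hY'
    have h3 := hcon X subset_rfl (Y \ Y') sdiff_subset
    have e1 := sum_sdiff hX' (f := fun i => ∑ j ∈ Y', (M i j - p))
    have e2 : ∑ i ∈ X, ∑ j ∈ Y \ Y', (M i j - p) + ∑ i ∈ X, ∑ j ∈ Y', (M i j - p) = 0 := by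
      rw [← sum_add_distrib, ← htot]
      exact sum_congr rfl fun i _ => sum_sdiff hY'
    rw [abs_le]
    constructor <;> linarith
  have hfro := sum_sum_maskedShift_sq hM X Y hsum
  have hF : p * (#X * #Y) / 2 ≤ ∑ i, ∑ j, maskedShift M p X Y i j ^ 2 := by
    rw [hfro]
    have : 0 < p * (#X * #Y : ℝ) := by positivity
    nlinarith
  set m : ℝ := (#X * #Y : ℝ) with hm
  have hmpos : 0 < m := by positivity
  have ht2 : (√(p / r) * √m / 2) ^ 2 * (2 * r) = p * m / 2 := by
    rw [div_pow, mul_pow, Real.sq_sqrt (by positivity), Real.sq_sqrt hmpos.le]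
    field_simp
  have key := mul_frobenius_le_of_rectangle_sums_le (maskedShift M p X Y) (R := 2 * r)
    (t := √(p / r) * √m / 2) (a := 9 * p * #Y) (b := 9 * p * #X) (D := 2 * δ)
    (by
      have h1 := rank_maskedShift_le M p X Y
      have h2 : (maskedShift M p X Y).rank ≤ 2 * r := by omega
      exact_mod_cast h2)
    (by positivity) (ht2.trans_le hF) (by positivity) (by positivity)
    (fun i => (sum_maskedShift_sq_row_le hM hp.le hp2 X Y hrow (by positivity) i).trans
      (by linarith))
    (fun j => by
      have h := sum_maskedShift_sq_row_le (M := M.transpose) (fun i j => hM j i) hp.le hp2 Y X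
        hcol (by positivity) j
      rw [← maskedShift_transpose] at h
      simp only [Matrix.transpose_apply] at h
      linarith)
    (fun X' Y' => by
      rw [sum_sum_maskedShift]
      exact hsub _ inter_subset_right _ inter_subset_right)
  have hab : √(9 * p * #Y * (9 * p * #X)) = 9 * p * √m := by
    rw [show 9 * p * #Y * (9 * p * #X) = (9 * p) ^ 2 * m by rw [hm]; ring,
      Real.sqrt_mul (by positivity), Real.sqrt_sq (by positivity)]
  rw [hab] at key
  have hs : 0 < √(p / r) := Real.sqrt_pos.2 (by positivity)
  have hsm : 0 < √m := Real.sqrt_pos.2 hmpos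
  have h1 : √(p / r) * √m / 2 * (p * m / 2) ≤ 9 * p * √m * (392 * (2 * δ)) :=
    (mul_le_mul_of_nonneg_left hF (by positivity)).trans key
  have h2 : 0 < √(p / r) * √m * p * m := by positivity
  have h3 : 9 * p * √m * (392 * (2 * δ)) = 7056 / 30000 * (√(p / r) * √m * p * m) := by
    rw [hδ]; ring
  linarith

/-- Discarding the elements where `f` is more than twice its average keeps at least half of the
elements and does not increase the average. -/
lemma exists_subset_le_two_mul_average {ι : Type} (s : Finset ι) (f : ι → ℝ) {a : ℝ}
    (ha : 0 ≤ a) (hf : ∀ i, 0 ≤ f i) (hs : ∑ i ∈ s, f i ≤ a * #s) :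
    ∃ t ⊆ s, (#s : ℝ) ≤ 2 * #t ∧ (∀ i ∈ t, f i ≤ 2 * a) ∧ ∑ i ∈ t, f i ≤ a * #t := by
  classical
  have hcard : (#{i ∈ s | f i ≤ 2 * a} : ℝ) + #{i ∈ s | ¬ f i ≤ 2 * a} = #s := by
    exact_mod_cast card_filter_add_card_filter_not (s := s) (fun i => f i ≤ 2 * a)
  have hsplit := sum_filter_add_sum_filter_not s (fun i => f i ≤ 2 * a) f
  have hbad : 2 * a * #{i ∈ s | ¬ f i ≤ 2 * a} ≤ ∑ i ∈ s with ¬ f i ≤ 2 * a, f i := by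
    have := card_nsmul_le_sum {i ∈ s | ¬ f i ≤ 2 * a} f (2 * a)
      fun i hi => (not_le.1 (mem_filter.1 hi).2).le
    rw [nsmul_eq_mul] at this
    linarith
  refine ⟨{i ∈ s | f i ≤ 2 * a}, filter_subset _ _, ?_, fun i hi => (mem_filter.1 hi).2, ?_⟩
  · by_contra! hlt
    have hne : {i ∈ s | ¬ f i ≤ 2 * a}.Nonempty := by
      rw [← card_pos]
      by_contra h0
      have : #{i ∈ s | ¬ f i ≤ 2 * a} = 0 := by omega
      rw [this] at hcard
      push_cast at hcard
      have : (0 : ℝ) ≤ #{i ∈ s | f i ≤ 2 * a} := by positivity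
      linarith
    have hbad' : ∑ i ∈ s with ¬ f i ≤ 2 * a, 2 * a < ∑ i ∈ s with ¬ f i ≤ 2 * a, f i :=
      sum_lt_sum_of_nonempty hne fun i hi => not_le.1 (mem_filter.1 hi).2
    rw [sum_const, nsmul_eq_mul] at hbad'
    have : 0 ≤ ∑ i ∈ s with f i ≤ 2 * a, f i := sum_nonneg fun i _ => hf i
    nlinarith
  · have : 0 ≤ a * #{i ∈ s | ¬ f i ≤ 2 * a} := by positivity
    nlinarith

/-- A sparse enough low-rank Boolean matrix has a zero submatrix of proportional size. -/
lemma exists_zero_rectangle_of_sparse {ι κ : Type} [Fintype ι] [Fintype κ] {M : Matrix ι κ ℝ}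
    (hM : ∀ i j, M i j = 0 ∨ M i j = 1) {r : ℕ} (hrank : M.rank ≤ r) {p : ℝ} (hp : 0 ≤ p)
    (hpr : 4 * r * p ≤ 1) (X : Finset ι) (Y : Finset κ)
    (hsum : ∑ i ∈ X, ∑ j ∈ Y, M i j ≤ p * (#X * #Y)) :
    ∃ (X' : Finset ι) (Y' : Finset κ), (#X : ℝ) ≤ 2 * #X' ∧ (#Y : ℝ) ≤ 2 * #Y' ∧
      ∀ i ∈ X', ∀ j ∈ Y', M i j = 0 := by
  classical
  have hM0 : ∀ i j, 0 ≤ M i j := fun i j => by rcases hM i j with h | h <;> simp [h]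
  obtain ⟨X', -, hX'card, hX'deg, -⟩ := exists_subset_le_two_mul_average X
    (fun i => ∑ j ∈ Y, M i j) (a := p * #Y) (by positivity)
    (fun i => sum_nonneg fun j _ => hM0 i j) (by linarith)
  obtain ⟨b, hbX, hbspan, hbli⟩ := exists_linearIndependent ℝ (M.row '' (X' : Set ι))
  have hbfin : b.Finite := ((X'.finite_toSet.image _).subset hbX)
  obtain ⟨B, rfl⟩ := hbfin.exists_finset_coe
  have hBcard : #B ≤ r := by
    refine le_trans ?_ hrank
    rw [← finrank_span_finset_eq_card hbli, M.rank_eq_finrank_span_row]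
    exact Submodule.finrank_mono (Submodule.span_mono (hbX.trans (Set.image_subset_range _ _)))
  let Y' : Finset κ := {j ∈ Y | ∀ v ∈ B, v j = 0}
  have hY' : (#Y : ℝ) ≤ 2 * #Y' := by
    have h1 : (#{j ∈ Y | ¬ ∀ v ∈ B, v j = 0} : ℝ) ≤ ∑ v ∈ B, ∑ j ∈ Y, v j := by
      rw [sum_comm, card_eq_sum_ones, Nat.cast_sum, sum_filter]
      refine sum_le_sum fun j _ => ?_
      have hv0 : ∀ v ∈ B, 0 ≤ v j := by
        intro v hv
        obtain ⟨i, -, rfl⟩ := hbX hv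
        exact hM0 i j
      by_cases h : ∀ v ∈ B, v j = 0
      · rw [if_neg (not_not.2 h)]
        exact sum_nonneg hv0
      · rw [if_pos h]
        push Not at h
        obtain ⟨v, hv, hvj⟩ := h
        refine le_trans ?_ (single_le_sum hv0 hv)
        obtain ⟨i, -, rfl⟩ := hbX hv
        rcases hM i j with h | h
        · exact absurd h hvj
        · simp [Matrix.row, h]
    have h2 : ∑ v ∈ B, ∑ j ∈ Y, v j ≤ #B * (2 * (p * #Y)) := by
      rw [← nsmul_eq_mul]
      refine sum_le_card_nsmul _ _ _ fun v hv => ?_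
      obtain ⟨i, hi, rfl⟩ := hbX hv
      exact hX'deg i hi
    have h3 : (#B : ℝ) * (2 * (p * #Y)) ≤ r * (2 * (p * #Y)) := by gcongr
    have h4 : (#Y' : ℝ) + #{j ∈ Y | ¬ ∀ v ∈ B, v j = 0} = #Y := by
      exact_mod_cast card_filter_add_card_filter_not (s := Y) (fun j => ∀ v ∈ B, v j = 0)
    have h5 : 4 * r * p * #Y ≤ 1 * #Y := by gcongr
    linarith
  refine ⟨X', Y', hX'card, hY', fun i hi j hj => ?_⟩
  have hmem : M.row i ∈ Submodule.span ℝ (B : Set (κ → ℝ)) := by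
    rw [hbspan]
    exact Submodule.subset_span ⟨i, hi, rfl⟩
  have hle : Submodule.span ℝ (B : Set (κ → ℝ)) ≤ LinearMap.ker (LinearMap.proj j) :=
    Submodule.span_le.2 fun v hv => (mem_filter.1 hj).2 v hv
  exact hle hmem

lemma mul_exp_neg_le_mul_exp_neg {x y a b g : ℝ} (hy : 0 ≤ y) (hxy : x ≤ g * y)
    (hg : g ≤ 1 + (a - b)) : x * Real.exp (-a) ≤ y * Real.exp (-b) := by
  have h1 : g ≤ Real.exp (a - b) := hg.trans (by linarith [Real.add_one_le_exp (a - b)])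
  have h2 : x ≤ Real.exp (a - b) * y := hxy.trans (mul_le_mul_of_nonneg_right h1 hy)
  calc x * Real.exp (-a) ≤ Real.exp (a - b) * y * Real.exp (-a) :=
        mul_le_mul_of_nonneg_right h2 (Real.exp_pos _).le
    _ = y * (Real.exp (a - b) * Real.exp (-a)) := by ring
    _ = y * Real.exp (-b) := by rw [← Real.exp_add]; ring_nf

/-- Passing to a suitable submatrix lowers the density, at a cost in size that is controlled by the
decrease of `√(r * density)`. -/
lemma exists_density_decrement {ι κ : Type} [Fintype ι] [Fintype κ] {M : Matrix ι κ ℝ}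
    (hM : ∀ i j, M i j = 0 ∨ M i j = 1) {r : ℕ} (hr : 1 ≤ r) (hrank : M.rank ≤ r) {p : ℝ}
    (hpr : 1 < 4 * r * p) (hp2 : p ≤ 1 / 2) {X : Finset ι} {Y : Finset κ}
    (hX : X.Nonempty) (hY : Y.Nonempty) (hsum : ∑ i ∈ X, ∑ j ∈ Y, M i j = p * (#X * #Y)) :
    ∃ X' ⊆ X, ∃ Y' ⊆ Y, ∃ p' : ℝ, X'.Nonempty ∧ Y'.Nonempty ∧ 0 ≤ p' ∧ p' < p ∧
      ∑ i ∈ X', ∑ j ∈ Y', M i j = p' * (#X' * #Y') ∧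
      (#X : ℝ) * Real.exp (-(120000 * √(r * p))) ≤
        #X' * Real.exp (-(120000 * √(r * p'))) ∧
      (#Y : ℝ) * Real.exp (-(120000 * √(r * p))) ≤
        #Y' * Real.exp (-(120000 * √(r * p'))) := by
  classical
  have hM0 : ∀ i j, 0 ≤ M i j := fun i j => by rcases hM i j with h | h <;> simp [h]
  have hrpos : (0 : ℝ) < r := by exact_mod_cast hr
  have hp : 0 < p := by
    by_contra! h
    nlinarith
  have hXpos : (0 : ℝ) < #X := by exact_mod_cast hX.card_pos
  have hYpos : (0 : ℝ) < #Y := by exact_mod_cast hY.card_pos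
  obtain ⟨X₁, hX₁, hX₁card, hrow, hX₁sum⟩ := exists_subset_le_two_mul_average X
    (fun i => ∑ j ∈ Y, M i j) (a := p * #Y) (by positivity)
    (fun i => sum_nonneg fun j _ => hM0 i j) (by linarith)
  obtain ⟨Y₁, hY₁, hY₁card, hcol, hY₁sum⟩ := exists_subset_le_two_mul_average Y
    (fun j => ∑ i ∈ X₁, M i j) (a := p * #X₁) (by positivity)
    (fun j => sum_nonneg fun i _ => hM0 i j) (sum_comm.trans_le (by linarith))
  replace hY₁sum := sum_comm.trans_le hY₁sum
  have hX₁pos : (0 : ℝ) < #X₁ := by linarith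
  have hY₁pos : (0 : ℝ) < #Y₁ := by linarith
  have hX₁ne : X₁.Nonempty := by
    rw [← card_pos]; exact_mod_cast hX₁pos
  have hY₁ne : Y₁.Nonempty := by
    rw [← card_pos]; exact_mod_cast hY₁pos
  have hm₁ : (0 : ℝ) < #X₁ * #Y₁ := by positivity
  obtain ⟨p₁, hp₁⟩ : ∃ p₁ : ℝ, ∑ i ∈ X₁, ∑ j ∈ Y₁, M i j = p₁ * (#X₁ * #Y₁) :=
    ⟨_, (div_mul_cancel₀ _ hm₁.ne').symm⟩
  have hp₁0 : 0 ≤ p₁ := by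
    refine nonneg_of_mul_nonneg_left ?_ hm₁
    rw [← hp₁]
    exact sum_nonneg fun i _ => sum_nonneg fun j _ => hM0 i j
  have hp₁p : p₁ ≤ p := by
    refine le_of_mul_le_mul_right ?_ hm₁
    rw [← hp₁]
    linarith
  set q := √(r * p) with hq
  have hq2 : q ^ 2 = r * p := Real.sq_sqrt (by positivity)
  have hq0 : 0 ≤ q := Real.sqrt_nonneg _
  rcases le_or_gt p₁ (p / 2) with hhalf | hhalf
  · have hq₁ : √(r * p₁) ≤ 3 / 4 * q := by
      refine Real.sqrt_le_iff.2 ⟨by positivity, ?_⟩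
      rw [mul_pow, hq2]
      nlinarith
    have hqlow : 1 / 2 ≤ q := Real.le_sqrt_of_sq_le (by linarith)
    have hg : (2 : ℝ) ≤ 1 + (120000 * q - 120000 * √(r * p₁)) := by linarith
    exact ⟨X₁, hX₁, Y₁, hY₁, p₁, hX₁ne, hY₁ne, hp₁0, by linarith, hp₁,
      mul_exp_neg_le_mul_exp_neg hX₁pos.le hX₁card hg,
      mul_exp_neg_le_mul_exp_neg hY₁pos.le hY₁card hg⟩
  have hp₁pos : 0 < p₁ := by linarith
  obtain ⟨X₂, hX₂, Y₂, hY₂, hdec⟩ := exists_rectangle_sum_sub_le hM hr hrank hp₁pos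
    (hp₁p.trans hp2) hX₁ne hY₁ne hp₁
    (fun i hi => by
      have h1 : ∑ j ∈ Y₁, M i j ≤ ∑ j ∈ Y, M i j :=
        sum_le_sum_of_subset_of_nonneg hY₁ fun j _ _ => hM0 i j
      have h2 := hrow i hi
      have h3 : p * #Y ≤ p * (2 * #Y₁) := by gcongr
      have h4 : p / 2 * #Y₁ ≤ p₁ * #Y₁ := by gcongr
      linarith)
    (fun j hj => by
      have h2 := hcol j hj
      have h4 : p / 2 * #X₁ ≤ p₁ * #X₁ := by gcongr
      have h5 : 0 ≤ p₁ * #X₁ := by positivity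
      linarith)
  have hloss : 0 < 1 / 30000 * √(p₁ / r) * (#X₁ * #Y₁ : ℝ) := by positivity
  have hX₂ne : X₂.Nonempty := by
    rw [nonempty_iff_ne_empty]
    rintro rfl
    simp only [sum_empty] at hdec
    linarith
  have hY₂ne : Y₂.Nonempty := by
    rw [nonempty_iff_ne_empty]
    rintro rfl
    simp only [sum_empty, sum_const_zero] at hdec
    linarith
  have hX₂pos : (0 : ℝ) < #X₂ := by exact_mod_cast hX₂ne.card_pos
  have hY₂pos : (0 : ℝ) < #Y₂ := by exact_mod_cast hY₂ne.card_pos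
  have hm₂ : (0 : ℝ) < #X₂ * #Y₂ := by positivity
  obtain ⟨p₂, hp₂⟩ : ∃ p₂ : ℝ, ∑ i ∈ X₂, ∑ j ∈ Y₂, M i j = p₂ * (#X₂ * #Y₂) :=
    ⟨_, (div_mul_cancel₀ _ hm₂.ne').symm⟩
  have hp₂0 : 0 ≤ p₂ := by
    refine nonneg_of_mul_nonneg_left ?_ hm₂
    rw [← hp₂]
    exact sum_nonneg fun i _ => sum_nonneg fun j _ => hM0 i j
  rw [sum_sum_sub_eq, hp₂] at hdec
  set β : ℝ := (#X₁ * #Y₁ : ℝ) / (#X₂ * #Y₂) with hβ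
  have hβpos : 0 < β := by positivity
  have hβm : β * (#X₂ * #Y₂) = #X₁ * #Y₁ := div_mul_cancel₀ _ hm₂.ne'
  have hdrop : p₂ - p₁ ≤ -(1 / 30000 * √(p₁ / r) * β) := by
    refine le_of_mul_le_mul_right ?_ hm₂
    rw [← hβm] at hdec
    linarith
  have hp₂₁ : p₂ < p₁ := by
    have : 0 < 1 / 30000 * √(p₁ / r) * β := by positivity
    linarith
  set q₁ := √(r * p₁) with hq₁
  set q₂ := √(r * p₂) with hq₂
  have hq₁2 : q₁ ^ 2 = r * p₁ := Real.sq_sqrt (by positivity)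
  have hq₂2 : q₂ ^ 2 = r * p₂ := Real.sq_sqrt (by positivity)
  have hq₁pos : 0 < q₁ := Real.sqrt_pos.2 (by positivity)
  have hq₂0 : 0 ≤ q₂ := Real.sqrt_nonneg _
  have hq₁q : q₁ ≤ q := Real.sqrt_le_sqrt (by gcongr)
  have hq₂₁ : q₂ ≤ q₁ := Real.sqrt_le_sqrt (by gcongr)
  have hrs : r * √(p₁ / r) = q₁ := by
    rw [hq₁, show (r : ℝ) * p₁ = r ^ 2 * (p₁ / r) by field_simp, Real.sqrt_mul (by positivity),
      Real.sqrt_sq hrpos.le]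
  have hdiff : 1 / 60000 * β ≤ q₁ - q₂ := by
    have h1 : 1 / 30000 * q₁ * β ≤ q₁ ^ 2 - q₂ ^ 2 := by
      rw [hq₁2, hq₂2]
      have := mul_le_mul_of_nonneg_left hdrop hrpos.le
      calc 1 / 30000 * q₁ * β = 1 / 30000 * (r * √(p₁ / r)) * β := by rw [hrs]
        _ ≤ _ := by linarith
    refine le_of_mul_le_mul_left ?_ hq₁pos
    nlinarith
  have hg : 2 * β ≤ 1 + (120000 * q - 120000 * q₂) := by linarith
  have hX₂le : (#X₂ : ℝ) ≤ #X₁ := by exact_mod_cast card_le_card hX₂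
  have hY₂le : (#Y₂ : ℝ) ≤ #Y₁ := by exact_mod_cast card_le_card hY₂
  have hXβ : (#X₁ : ℝ) ≤ β * #X₂ := by
    refine le_of_mul_le_mul_right ?_ hY₂pos
    rw [mul_assoc, hβm]
    gcongr
  have hYβ : (#Y₁ : ℝ) ≤ β * #Y₂ := by
    refine le_of_mul_le_mul_left ?_ hX₂pos
    calc (#X₂ : ℝ) * #Y₁ ≤ #X₁ * #Y₁ := by gcongr
      _ = _ := by rw [← hβm]; ring
  exact ⟨X₂, hX₂.trans hX₁, Y₂, hY₂.trans hY₁, p₂, hX₂ne, hY₂ne, hp₂0, by linarith, hp₂,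
    mul_exp_neg_le_mul_exp_neg hX₂pos.le (by linarith) hg,
    mul_exp_neg_le_mul_exp_neg hY₂pos.le (by linarith) hg⟩

lemma exists_zero_rectangle {ι κ : Type} [Fintype ι] [Fintype κ] {M : Matrix ι κ ℝ}
    (hM : ∀ i j, M i j = 0 ∨ M i j = 1) {r : ℕ} (hr : 1 ≤ r) (hrank : M.rank ≤ r) (N : ℕ) :
    ∀ (X : Finset ι) (Y : Finset κ) (p : ℝ), #X + #Y ≤ N → X.Nonempty → Y.Nonempty →
      0 ≤ p → p ≤ 1 / 2 → ∑ i ∈ X, ∑ j ∈ Y, M i j = p * (#X * #Y) →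
      ∃ (X' : Finset ι) (Y' : Finset κ),
        (#X : ℝ) * Real.exp (-(120000 * √(r * p))) ≤ 2 * #X' ∧
        (#Y : ℝ) * Real.exp (-(120000 * √(r * p))) ≤ 2 * #Y' ∧
        ∀ i ∈ X', ∀ j ∈ Y', M i j = 0 := by
  induction N with
  | zero =>
    intro X Y p hN hX
    have := hX.card_pos
    omega
  | succ N ih =>
    intro X Y p hN hX hY hp hp2 hsum
    rcases le_or_gt (4 * r * p) 1 with hpr | hpr
    · obtain ⟨X', Y', hX', hY', hz⟩ := exists_zero_rectangle_of_sparse hM hrank hp hpr X Y hsum.le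
      have he : Real.exp (-(120000 * √(r * p))) ≤ 1 :=
        Real.exp_le_one_iff.2 (neg_nonpos.2 (by positivity))
      exact ⟨X', Y', (mul_le_of_le_one_right (by positivity) he).trans hX',
        (mul_le_of_le_one_right (by positivity) he).trans hY', hz⟩
    · obtain ⟨X₁, hX₁, Y₁, hY₁, p₁, hX₁ne, hY₁ne, hp₁, hlt, hsum₁, hXe, hYe⟩ :=
        exists_density_decrement hM hr hrank hpr hp2 hX hY hsum
      have hcard : #X₁ + #Y₁ ≤ N := by
        by_contra hc
        have hcX := card_le_card hX₁
        have hcY := card_le_card hY₁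
        obtain rfl : X₁ = X := eq_of_subset_of_card_le hX₁ (by omega)
        obtain rfl : Y₁ = Y := eq_of_subset_of_card_le hY₁ (by omega)
        have hpos : (0 : ℝ) < #X₁ * #Y₁ := by
          exact_mod_cast Nat.mul_pos hX₁ne.card_pos hY₁ne.card_pos
        rw [hsum] at hsum₁
        exact hlt.ne' (mul_right_cancel₀ hpos.ne' hsum₁)
      obtain ⟨X', Y', hX', hY', hz⟩ := ih X₁ Y₁ p₁ hcard hX₁ne hY₁ne hp₁ (by linarith) hsum₁
      exact ⟨X', Y', hXe.trans hX', hYe.trans hY', hz⟩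

theorem stmt14 :
    ∃ c : ℝ, 0 < c ∧
      ∀ (n r : ℕ) (M : Matrix (Fin n) (Fin n) ℝ),
        (∀ i j, M i j = 0 ∨ M i j = 1) →
        M.rank ≤ r →
        (∑ i, ∑ j, M i j) / (n * n : ℝ) ≤ 1 / 2 →
        ∃ X Y : Finset (Fin n),
          (n : ℝ) / 2 ^ (c * Real.sqrt r) ≤ X.card ∧
          (n : ℝ) / 2 ^ (c * Real.sqrt r) ≤ Y.card ∧
          ∀ i ∈ X, ∀ j ∈ Y, M i j = 0 := by
  have hlog : 0 < Real.log 2 := Real.log_pos one_lt_two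
  refine ⟨120001 / Real.log 2, by positivity, fun n r M hM hrank hdens => ?_⟩
  rcases Nat.eq_zero_or_pos n with rfl | hn
  · exact ⟨∅, ∅, by simp, by simp, by simp⟩
  have hnpos : (0 : ℝ) < n := by exact_mod_cast hn
  rcases Nat.eq_zero_or_pos r with rfl | hr
  · have hspan : Submodule.span ℝ (Set.range M.row) = ⊥ := by
      rw [← Submodule.finrank_eq_zero, ← M.rank_eq_finrank_span_row]
      exact Nat.le_zero.1 hrank
    refine ⟨univ, univ, by simp, by simp, fun i _ j _ => ?_⟩
    exact congrFun (Submodule.span_eq_bot.1 hspan (M.row i) ⟨i, rfl⟩) j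
  set p : ℝ := (∑ i, ∑ j, M i j) / (n * n : ℝ) with hp
  have hp0 : 0 ≤ p := by
    refine div_nonneg (sum_nonneg fun i _ => sum_nonneg fun j _ => ?_) (by positivity)
    rcases hM i j with h | h <;> simp [h]
  have : Nonempty (Fin n) := ⟨⟨0, hn⟩⟩
  obtain ⟨X, Y, hX, hY, hz⟩ := exists_zero_rectangle hM hr hrank _ univ univ p le_rfl
    univ_nonempty univ_nonempty hp0 hdens (by
      rw [card_univ, Fintype.card_fin]
      exact (div_mul_cancel₀ _ (by positivity)).symm)
  have hbound : (n : ℝ) / 2 ^ (120001 / Real.log 2 * √r) ≤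
      n * Real.exp (-(120000 * √(r * p))) / 2 := by
    have h1 : (1 : ℝ) ≤ √r := Real.one_le_sqrt.2 (by exact_mod_cast hr)
    have h2 : √(r * p) ≤ √r := Real.sqrt_le_sqrt (mul_le_of_le_one_right (by positivity)
      (by linarith))
    have h3 : (2 : ℝ) ≤ Real.exp 1 := by linarith [Real.add_one_le_exp 1]
    rw [Real.rpow_def_of_pos two_pos, div_eq_mul_inv, ← Real.exp_neg, mul_div_assoc]
    refine mul_le_mul_of_nonneg_left ?_ hnpos.le
    rw [le_div_iff₀ two_pos]
    calc Real.exp (-(Real.log 2 * (120001 / Real.log 2 * √r))) * 2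
        ≤ Real.exp (-(120001 * √r)) * Real.exp 1 := by
          rw [← mul_assoc, mul_div_cancel₀ _ hlog.ne']
          gcongr
      _ = Real.exp (-(120001 * √r) + 1) := (Real.exp_add _ _).symm
      _ ≤ _ := Real.exp_le_exp.2 (by linarith)
  rw [card_univ, Fintype.card_fin] at hX hY
  exact ⟨X, Y, by linarith, by linarith, hz⟩
end

section
/- There exists a constant c > 0 such that every binary matrix M ∈ {0,1}^{m×n} with rank(M) ≤ r contains a submatrix with at least m/2^{c√r} rows and n/2^{c√r} columns that is entirely 0 or entirely 1. -/
open Finset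

theorem Matrix.rank_sub_le {ι κ : Type*} [Finite ι] [Fintype κ] (A B : Matrix ι κ ℝ) :
    (A - B).rank ≤ A.rank + B.rank := by
  refine le_trans (Submodule.finrank_mono ?_)
    (Submodule.finrank_add_le_finrank_add_finrank (LinearMap.range A.mulVecLin)
      (LinearMap.range B.mulVecLin))
  rintro _ ⟨w, rfl⟩
  rw [Matrix.mulVecLin_apply, Matrix.sub_mulVec]
  exact Submodule.sub_mem_sup ⟨w, rfl⟩ ⟨w, rfl⟩

/-- Rows as vectors, columns as projections of the standard basis onto the row space. -/
theorem Matrix.exists_rank_factorization {ι κ : Type*} [Fintype ι] [Fintype κ]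
    (M : Matrix ι κ ℝ) :
    ∃ u : ι → EuclideanSpace ℝ κ, ∃ v : κ → EuclideanSpace ℝ κ,
      (∀ i j, inner ℝ (u i) (v j) = M i j) ∧ (∀ i, ‖u i‖ ^ 2 = ∑ j, M i j ^ 2) ∧
      ∑ j, ‖v j‖ ^ 2 = M.rank := by
  classical
  set u : ι → EuclideanSpace ℝ κ := fun i => WithLp.toLp 2 (M i) with hu
  set U : Submodule ℝ (EuclideanSpace ℝ κ) := Submodule.span ℝ (Set.range u) with hU
  let e := EuclideanSpace.basisFun κ ℝ
  have hrank : Module.finrank ℝ U = M.rank := by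
    rw [Matrix.rank_eq_finrank_span_row]
    have hmap : U = (Submodule.span ℝ (Set.range M.row)).map
        ((WithLp.linearEquiv 2 ℝ (κ → ℝ)).symm : (κ → ℝ) →ₗ[ℝ] EuclideanSpace ℝ κ) := by
      rw [Submodule.map_span, ← Set.range_comp]
      rfl
    rw [hmap, LinearEquiv.finrank_map_eq]
  refine ⟨u, fun j => U.starProjection (e j), fun i j => ?_, fun i => ?_, ?_⟩
  · have hmem : u i ∈ U := Submodule.subset_span ⟨i, rfl⟩
    rw [← Submodule.inner_starProjection_left_eq_right, Submodule.starProjection_eq_self_iff.2 hmem]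
    simp [e, hu, EuclideanSpace.inner_single_right]
  · simp [EuclideanSpace.norm_sq_eq, hu]
  · let b := stdOrthonormalBasis ℝ U
    have h1 : ∀ j, ‖U.starProjection (e j)‖ ^ 2 =
        ∑ k, (inner ℝ (b k : EuclideanSpace ℝ κ) (e j)) ^ 2 := by
      intro j
      have h := b.sum_sq_norm_inner_right (U.orthogonalProjectionOnto (e j))
      rw [Submodule.starProjection_apply, ← Submodule.coe_norm, ← h]
      refine Finset.sum_congr rfl fun k _ => ?_
      rw [Real.norm_eq_abs, sq_abs, Submodule.coe_inner, ← Submodule.starProjection_apply,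
        ← Submodule.inner_starProjection_left_eq_right,
        Submodule.starProjection_eq_self_iff.2 (b k).2]
    simp_rw [h1]
    rw [Finset.sum_comm]
    have h2 : ∀ k, ∑ j, (inner ℝ (b k : EuclideanSpace ℝ κ) (e j)) ^ 2 = 1 := by
      intro k
      have h := e.sum_sq_norm_inner_left (b k : EuclideanSpace ℝ κ)
      simp only [Real.norm_eq_abs, sq_abs] at h
      rw [h, ← Submodule.coe_norm, b.orthonormal.1 k, one_pow]
    simp [h2, hrank]

section Gaussian

open MeasureTheory ProbabilityTheory

variable {E : Type*} [NormedAddCommGroup E] [InnerProductSpace ℝ E] [FiniteDimensional ℝ E]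
  [MeasurableSpace E] [BorelSpace E]

theorem integrable_stdGaussian_of_bounded {F : E → ℝ} (hF : Continuous F)
    {K : ℝ} (hK : ∀ x, |F x| ≤ K) : Integrable F (stdGaussian E) :=
  Integrable.of_bound hF.aestronglyMeasurable K (.of_forall hK)

theorem integral_cos_inner_stdGaussian (t : E) :
    ∫ x, Real.cos (inner ℝ x t) ∂(stdGaussian E) = Real.exp (-‖t‖ ^ 2 / 2) := by
  have h := congrArg Complex.re (charFun_stdGaussian t)
  have hi : Integrable (fun x : E => Complex.exp (inner ℝ x t * Complex.I)) (stdGaussian E) := by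
    refine Integrable.of_bound (by fun_prop) 1 (.of_forall fun x => ?_)
    rw [Complex.norm_exp_ofReal_mul_I]
  rw [charFun_apply] at h
  have h2 := integral_re hi
  simp only [RCLike.re_eq_complex_re] at h2
  rw [← h2] at h
  simp only [Complex.exp_ofReal_mul_I_re] at h
  rw [h]
  norm_cast

theorem integral_sin_inner_stdGaussian (t : E) :
    ∫ x, Real.sin (inner ℝ x t) ∂(stdGaussian E) = 0 := by
  have h := congrArg Complex.im (charFun_stdGaussian t)
  have hi : Integrable (fun x : E => Complex.exp (inner ℝ x t * Complex.I)) (stdGaussian E) := by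
    refine Integrable.of_bound (by fun_prop) 1 (.of_forall fun x => ?_)
    rw [Complex.norm_exp_ofReal_mul_I]
  rw [charFun_apply] at h
  have h2 := integral_im hi
  simp only [RCLike.im_eq_complex_im] at h2
  rw [← h2] at h
  simp only [Complex.exp_ofReal_mul_I_im] at h
  rw [h]
  norm_cast

theorem integral_sin_mul_sin_inner_stdGaussian (u v : E) :
    ∫ x, Real.sin (inner ℝ x u) * Real.sin (inner ℝ x v) ∂(stdGaussian E) =
      Real.exp (-(‖u‖ ^ 2 + ‖v‖ ^ 2) / 2) * Real.sinh (inner ℝ u v) := by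
  have hc : ∀ t : E, Integrable (fun x : E => Real.cos (inner ℝ x t)) (stdGaussian E) := fun t =>
    integrable_stdGaussian_of_bounded (by fun_prop) fun x => Real.abs_cos_le_one _
  have hprod : ∀ x : E, Real.sin (inner ℝ x u) * Real.sin (inner ℝ x v) =
      (Real.cos (inner ℝ x (u - v)) - Real.cos (inner ℝ x (u + v))) / 2 := by
    intro x
    rw [inner_sub_right, inner_add_right, Real.cos_sub, Real.cos_add]
    ring
  simp_rw [hprod]
  rw [integral_div, integral_sub (hc _) (hc _), integral_cos_inner_stdGaussian,
    integral_cos_inner_stdGaussian, norm_sub_sq_real, norm_add_sq_real, Real.sinh_eq,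
    mul_div_assoc', mul_sub, ← Real.exp_add, ← Real.exp_add]
  ring_nf

/-- Rounding of two families of vectors in the unit ball to two families of numbers in `[-1, 1]`. -/
theorem exists_rounding {ι κ : Type*} [Fintype ι] [Fintype κ] (u : ι → E) (v : κ → E)
    (hu : ∀ i, ‖u i‖ ≤ 1) (hv : ∀ j, ‖v j‖ ≤ 1) (C : ι → κ → ℝ) :
    ∃ f : ι → ℝ, ∃ g : κ → ℝ, (∀ i, |f i| ≤ 1) ∧ (∀ j, |g j| ≤ 1) ∧
      ∑ i, ∑ j, C i j * ((2 + f i) * (2 - g j)) ≤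
        ∑ i, ∑ j, C i j * (4 - Real.exp (-1) * Real.sinh (inner ℝ (u i) (v j))) := by
  let φ : E → E → ℝ := fun w x => Real.exp ((‖w‖ ^ 2 - 1) / 2) * Real.sin (inner ℝ x w)
  have hφ1 : ∀ w x, ‖w‖ ≤ 1 → |φ w x| ≤ 1 := by
    intro w x hw
    simp only [φ, abs_mul, Real.abs_exp]
    refine mul_le_one₀ (Real.exp_le_one_iff.2 ?_) (abs_nonneg _) (Real.abs_sin_le_one _)
    nlinarith [norm_nonneg w]
  have hφc : ∀ w, Continuous (φ w) := fun w => by fun_prop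
  have hφi : ∀ w, ‖w‖ ≤ 1 → Integrable (φ w) (stdGaussian E) := fun w hw =>
    integrable_stdGaussian_of_bounded (hφc w) fun x => hφ1 w x hw
  have hφφi : ∀ w z, ‖w‖ ≤ 1 → ‖z‖ ≤ 1 →
      Integrable (fun x => φ w x * φ z x) (stdGaussian E) := fun w z hw hz =>
    integrable_stdGaussian_of_bounded ((hφc w).mul (hφc z)) (K := 1) fun x => by
      rw [abs_mul]
      exact mul_le_one₀ (hφ1 w x hw) (abs_nonneg _) (hφ1 z x hz)
  have hφ0 : ∀ w, ∫ x, φ w x ∂(stdGaussian E) = 0 := fun w => by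
    simp only [φ]
    rw [integral_const_mul, integral_sin_inner_stdGaussian, mul_zero]
  have hφφ : ∀ w z, ∫ x, φ w x * φ z x ∂(stdGaussian E) =
      Real.exp (-1) * Real.sinh (inner ℝ w z) := fun w z => by
    have : ∀ x, φ w x * φ z x = Real.exp ((‖w‖ ^ 2 - 1) / 2 + (‖z‖ ^ 2 - 1) / 2) *
        (Real.sin (inner ℝ x w) * Real.sin (inner ℝ x z)) := fun x => by
      rw [Real.exp_add]; ring
    simp_rw [this]
    rw [integral_const_mul, integral_sin_mul_sin_inner_stdGaussian, ← mul_assoc, ← Real.exp_add]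
    ring_nf
  have hexp : ∀ i j x, C i j * ((2 + φ (u i) x) * (2 - φ (v j) x)) =
      C i j * (4 + 2 * φ (u i) x - 2 * φ (v j) x - φ (u i) x * φ (v j) x) := fun i j x => by ring
  have hint : ∀ i j, Integrable
      (fun x => C i j * ((2 + φ (u i) x) * (2 - φ (v j) x))) (stdGaussian E) := fun i j => by
    simp_rw [hexp]
    exact ((((integrable_const _).add ((hφi _ (hu i)).const_mul 2)).sub
      ((hφi _ (hv j)).const_mul 2)).sub (hφφi _ _ (hu i) (hv j))).const_mul _
  have hval : ∀ i j, ∫ x, C i j * ((2 + φ (u i) x) * (2 - φ (v j) x)) ∂(stdGaussian E) =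
      C i j * (4 - Real.exp (-1) * Real.sinh (inner ℝ (u i) (v j))) := fun i j => by
    simp_rw [hexp]
    have i1 := (hφi _ (hu i)).const_mul 2
    have i2 := (hφi _ (hv j)).const_mul 2
    have i3 : Integrable (fun x => 4 + 2 * φ (u i) x) (stdGaussian E) :=
      (integrable_const _).add i1
    have i4 : Integrable (fun x => 4 + 2 * φ (u i) x - 2 * φ (v j) x) (stdGaussian E) :=
      i3.sub i2
    rw [integral_const_mul, integral_sub i4 (hφφi _ _ (hu i) (hv j)), integral_sub i3 i2,
      integral_add (integrable_const _) i1, integral_const_mul 2 (φ (u i)),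
      integral_const_mul 2 (φ (v j)), hφφ, hφ0, hφ0]
    simp
  obtain ⟨x, hx⟩ := exists_le_integral (μ := stdGaussian E)
    (f := fun x => ∑ i, ∑ j, C i j * ((2 + φ (u i) x) * (2 - φ (v j) x)))
    (integrable_finsetSum _ fun i _ => integrable_finsetSum _ fun j _ => hint i j)
  refine ⟨fun i => φ (u i) x, fun j => φ (v j) x, fun i => hφ1 _ _ (hu i), fun j => hφ1 _ _ (hv j),
    hx.trans_eq ?_⟩
  rw [integral_finsetSum _ fun i _ => integrable_finsetSum _ fun j _ => hint i j]
  refine Finset.sum_congr rfl fun i _ => ?_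
  rw [integral_finsetSum _ fun j _ => hint i j]
  exact Finset.sum_congr rfl fun j _ => hval i j

end Gaussian

/-- The Markov inequality for a weighted finite set; `χ` is the indicator of the good points. -/
theorem markov_indicator {ι : Type*} [Fintype ι] (w e χ : ι → ℝ) {K t : ℝ} (hK : 0 < K)
    (ht : 0 < t) (he : ∀ i, 0 ≤ e i) (hsum : ∑ i, e i ≤ t * ∑ i, w i)
    (hχ : ∀ i, χ i = 1 ∨ χ i = 0 ∧ K * t * w i ≤ e i) :
    (1 - 1 / K) * ∑ i, w i ≤ ∑ i, w i * χ i := by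
  have h : ∑ i, K * t * (w i - w i * χ i) ≤ ∑ i, e i := by
    refine Finset.sum_le_sum fun i _ => ?_
    rcases hχ i with h | ⟨h, h'⟩
    · rw [h]; linarith [he i]
    · rw [h]; linarith
  rw [← Finset.mul_sum, Finset.sum_sub_distrib] at h
  have h2 : K * (∑ i, w i - ∑ i, w i * χ i) ≤ ∑ i, w i := by
    refine le_of_mul_le_mul_left ?_ ht
    linarith
  have h3 : ∑ i, w i - ∑ i, w i * χ i ≤ 1 / K * ∑ i, w i := by
    rw [one_div, inv_mul_eq_div, le_div_iff₀ hK]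
    linarith
  linarith

/-- A low-rank matrix with few ones contains a large zero submatrix. -/
theorem exists_zero_submatrix_of_sparse {ι κ : Type*} [Fintype ι] [Fintype κ] (M : Matrix ι κ ℝ)
    (hM : ∀ i j, M i j = 0 ∨ M i j = 1) {r : ℕ} (hr0 : 0 < r) (hr : M.rank ≤ r)
    (a : ι → ℝ) (b : κ → ℝ) (ha0 : ∀ i, 0 ≤ a i) (ha1 : ∀ i, a i ≤ 1)
    (hb0 : ∀ j, 0 ≤ b j) (hb1 : ∀ j, b j ≤ 1) (hB : 0 < ∑ j, b j)
    (hD : ∑ i, ∑ j, a i * b j * M i j ≤ 1 / (4 * r) * (∑ i, a i) * ∑ j, b j) :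
    ∃ (X : Finset ι) (Y : Finset κ), (∑ i, a i) / 2 ≤ X.card ∧ (∑ j, b j) / 2 ≤ Y.card ∧
      ∀ i ∈ X, ∀ j ∈ Y, M i j = 0 := by
  classical
  have hr0' : (0 : ℝ) < r := by exact_mod_cast hr0
  have hM0 : ∀ i j, 0 ≤ M i j := fun i j => by rcases hM i j with h | h <;> simp [h]
  set A := ∑ i, a i
  set B := ∑ j, b j
  set d : ι → ℝ := fun i => ∑ j, b j * M i j with hd
  have hd0 : ∀ i, 0 ≤ d i := fun i => Finset.sum_nonneg fun j _ => mul_nonneg (hb0 j) (hM0 i j)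
  set X : Finset ι := Finset.univ.filter fun i => d i ≤ B / (2 * r) with hX
  have hXcard : A / 2 ≤ X.card := by
    have h := markov_indicator a (fun i => a i * d i) (fun i => if i ∈ X then 1 else 0)
      (K := 2) (t := B / (4 * r)) two_pos (by positivity)
      (fun i => mul_nonneg (ha0 i) (hd0 i))
      (by
        refine le_trans (le_of_eq ?_) (hD.trans (le_of_eq ?_))
        · refine Finset.sum_congr rfl fun i _ => ?_
          simp only [hd, Finset.mul_sum, mul_assoc]
        · ring)
      (fun i => by
        by_cases hi : i ∈ X
        · simp [hi]
        · refine Or.inr ⟨by simp [hi], ?_⟩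
          have : B / (2 * r) < d i := by simpa [hX] using hi
          have e : 2 * (B / (4 * r)) = B / (2 * r) := by field_simp; ring
          rw [e, mul_comm]
          exact mul_le_mul_of_nonneg_left this.le (ha0 i))
    have h2 : ∑ i, a i * (if i ∈ X then (1 : ℝ) else 0) ≤ X.card := by
      simp only [mul_ite, mul_one, mul_zero, Finset.sum_ite_mem, Finset.univ_inter]
      calc ∑ i ∈ X, a i ≤ ∑ i ∈ X, (1 : ℝ) := Finset.sum_le_sum fun i _ => ha1 i
        _ = X.card := by simp
    linarith
  obtain ⟨t, htX, htcard, htspan, -⟩ :=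
    Submodule.exists_finset_span_eq_linearIndepOn ℝ (M.row '' (X : Set ι))
  have htr : (t.card : ℝ) ≤ r := by
    rw [htcard]
    refine Nat.cast_le.2 (le_trans ?_ hr)
    rw [Matrix.rank_eq_finrank_span_row]
    exact Submodule.finrank_mono (Submodule.span_mono (Set.image_subset_range _ _))
  set Y : Finset κ := Finset.univ.filter fun j => ∀ f ∈ t, f j = 0 with hY
  refine ⟨X, Y, hXcard, ?_, fun i hi j hj => ?_⟩
  · have ht0 : ∀ f ∈ t, ∀ j, f j = 0 ∨ f j = 1 := fun f hf j => by
      obtain ⟨i, -, rfl⟩ := htX hf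
      exact hM i j
    have htd : ∀ f ∈ t, ∑ j, b j * f j ≤ B / (2 * r) := fun f hf => by
      obtain ⟨i, hi, rfl⟩ := htX hf
      exact (Finset.mem_filter.1 hi).2
    have h1 : ∀ j, b j ≤ (if j ∈ Y then 1 else 0) + ∑ f ∈ t, b j * f j := by
      intro j
      have hn : ∀ f ∈ t, 0 ≤ b j * f j := fun f hf => by
        rcases ht0 f hf j with h | h <;> simp [h, hb0 j]
      by_cases hj : j ∈ Y
      · rw [if_pos hj]
        linarith [hb1 j, Finset.sum_nonneg hn]
      · rw [if_neg hj, zero_add]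
        have : ∃ f ∈ t, f j ≠ 0 := by simpa [hY] using hj
        obtain ⟨f, hf, hfj⟩ := this
        have hf1 : f j = 1 := (ht0 f hf j).resolve_left hfj
        calc b j = b j * f j := by rw [hf1, mul_one]
          _ ≤ _ := Finset.single_le_sum (f := fun f : κ → ℝ => b j * f j) hn hf
    have h2 : B ≤ Y.card + ∑ f ∈ t, ∑ j, b j * f j := by
      rw [Finset.sum_comm]
      calc B ≤ ∑ j, ((if j ∈ Y then 1 else 0) + ∑ f ∈ t, b j * f j) :=
            Finset.sum_le_sum fun j _ => h1 j
        _ = _ := by simp [Finset.sum_add_distrib]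
    have h3 : ∑ f ∈ t, ∑ j, b j * f j ≤ r * (B / (2 * r)) :=
      calc _ ≤ ∑ f ∈ t, B / (2 * r) := Finset.sum_le_sum htd
        _ = t.card * (B / (2 * r)) := by simp
        _ ≤ _ := mul_le_mul_of_nonneg_right htr (by positivity)
    have h4 : (r : ℝ) * (B / (2 * r)) = B / 2 := by field_simp
    linarith
  · have hj' : ∀ f ∈ t, f j = 0 := (Finset.mem_filter.1 hj).2
    have hmem : M.row i ∈ Submodule.span ℝ (t : Set (κ → ℝ)) := by
      rw [htspan]
      exact Submodule.subset_span ⟨i, hi, rfl⟩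
    have hle : Submodule.span ℝ (t : Set (κ → ℝ)) ≤ LinearMap.ker (LinearMap.proj (R := ℝ)
        (φ := fun _ : κ => ℝ) j) :=
      Submodule.span_le.2 fun f hf => hj' f hf
    exact hle hmem

/-- One step of the density decrement: if the ones have weighted density `x ^ 2`, then decreasing
each total weight by a factor of at most `4` makes the square root of the density drop by a
constant multiple of `1 / √r`. -/
theorem exists_density_decrement_s15 {ι κ : Type*} [Fintype ι] [Fintype κ] (M : Matrix ι κ ℝ)
    (hM : ∀ i j, M i j = 0 ∨ M i j = 1) {r : ℕ} (hr0 : 0 < r) (hr : M.rank ≤ r)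
    (a : ι → ℝ) (b : κ → ℝ) (ha0 : ∀ i, 0 ≤ a i) (hb0 : ∀ j, 0 ≤ b j)
    (hA : 0 < ∑ i, a i) (hB : 0 < ∑ j, b j) {x : ℝ} (hx : 1 / (2 * √r) ≤ x) (hx2 : x ^ 2 ≤ 1 / 2)
    (hD : ∑ i, ∑ j, a i * b j * M i j = x ^ 2 * (∑ i, a i) * ∑ j, b j) :
    ∃ (a' : ι → ℝ) (b' : κ → ℝ), (∀ i, 0 ≤ a' i) ∧ (∀ i, a' i ≤ a i) ∧ (∀ j, 0 ≤ b' j) ∧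
      (∀ j, b' j ≤ b j) ∧ (∑ i, a i) / 4 ≤ ∑ i, a' i ∧ (∑ j, b j) / 4 ≤ ∑ j, b' j ∧
      ∑ i, ∑ j, a' i * b' j * M i j ≤
        (x - 1 / (768 * √r)) ^ 2 * (∑ i, a' i) * ∑ j, b' j := by
  classical
  have hr0' : (0 : ℝ) < r := by exact_mod_cast hr0
  have hs : 0 < √(r : ℝ) := Real.sqrt_pos.2 hr0'
  have hx0 : 0 < x := lt_of_lt_of_le (by positivity) hx
  have hM0 : ∀ i j, 0 ≤ M i j := fun i j => by rcases hM i j with h | h <;> simp [h]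
  set A := ∑ i, a i
  set B := ∑ j, b j
  obtain ⟨u, v, huv, hu, hv⟩ := (M * Matrix.diagonal fun j => √(b j)).exists_rank_factorization
  simp only [Matrix.mul_diagonal] at huv hu
  have hu' : ∀ i, ‖u i‖ ^ 2 = ∑ j, b j * M i j := fun i => by
    rw [hu]
    refine Finset.sum_congr rfl fun j _ => ?_
    rw [mul_pow, Real.sq_sqrt (hb0 j)]
    rcases hM i j with h | h <;> simp [h]
  have hv' : ∑ j, ‖v j‖ ^ 2 ≤ r := by
    rw [hv]
    exact_mod_cast (Matrix.rank_mul_le_left _ _).trans hr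
  set χ : ι → ℝ := fun i => if ‖u i‖ ^ 2 ≤ 8 * (x ^ 2 * B) then 1 else 0 with hχ
  set ψ : κ → ℝ := fun j => if ‖v j‖ ^ 2 ≤ 8 * (r / B) * b j then 1 else 0 with hψ
  have hχ01 : ∀ i, χ i = 0 ∨ χ i = 1 := fun i => by
    simp only [hχ]; split_ifs <;> simp
  have hψ01 : ∀ j, ψ j = 0 ∨ ψ j = 1 := fun j => by
    simp only [hψ]; split_ifs <;> simp
  have hA' : 7 / 8 * A ≤ ∑ i, a i * χ i := by
    refine le_trans (le_of_eq ?_) (markov_indicator a (fun i => a i * ‖u i‖ ^ 2) χ (K := 8)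
      (t := x ^ 2 * B) (by norm_num) (by positivity) (fun i => mul_nonneg (ha0 i) (sq_nonneg _))
      (le_of_eq ?_) fun i => ?_)
    · norm_num [A]
    · rw [mul_right_comm, ← hD]
      refine Finset.sum_congr rfl fun i _ => ?_
      rw [hu', Finset.mul_sum]
      exact Finset.sum_congr rfl fun j _ => by ring
    · by_cases h : ‖u i‖ ^ 2 ≤ 8 * (x ^ 2 * B)
      · simp [hχ, h]
      · refine Or.inr ⟨by simp [hχ, h], ?_⟩
        rw [mul_comm]
        exact mul_le_mul_of_nonneg_left (not_le.1 h).le (ha0 i)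
  have hB' : 7 / 8 * B ≤ ∑ j, b j * ψ j := by
    refine le_trans (le_of_eq ?_) (markov_indicator b (fun j => ‖v j‖ ^ 2) ψ (K := 8)
      (t := r / B) (by norm_num) (by positivity) (fun i => sq_nonneg _)
      (hv'.trans (le_of_eq ?_)) fun j => ?_)
    · norm_num [B]
    · rw [div_mul_cancel₀ _ hB.ne']
    · by_cases h : ‖v j‖ ^ 2 ≤ 8 * (r / B) * b j
      · simp [hψ, h]
      · exact Or.inr ⟨by simp [hψ, h], (not_le.1 h).le⟩
  by_cases hcase : ∑ i, ∑ j, a i * χ i * (b j * ψ j) * M i j ≤ x ^ 2 / 2 * A * B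
  · refine ⟨fun i => a i * χ i, fun j => b j * ψ j, fun i => ?_, fun i => ?_, fun j => ?_,
      fun j => ?_, by linarith, by linarith, hcase.trans ?_⟩
    · rcases hχ01 i with h | h <;> simp [h, ha0 i]
    · rcases hχ01 i with h | h <;> simp [h, ha0 i]
    · rcases hψ01 j with h | h <;> simp [h, hb0 j]
    · rcases hψ01 j with h | h <;> simp [h, hb0 j]
    · have h1 : 383 / 384 * x ≤ x - 1 / (768 * √r) := by
        have : 1 / (768 * √(r : ℝ)) = 1 / (2 * √r) / 384 := by field_simp; norm_num
        rw [this]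
        linarith
      have h2 : (383 / 384 * x) ^ 2 ≤ (x - 1 / (768 * √r)) ^ 2 :=
        pow_le_pow_left₀ (by positivity) h1 2
      have h3 : (7 / 8 * A) * (7 / 8 * B) ≤ (∑ i, a i * χ i) * ∑ j, b j * ψ j :=
        mul_le_mul hA' hB' (by positivity) (le_trans (by positivity) hA')
      calc x ^ 2 / 2 * A * B ≤ (383 / 384 * x) ^ 2 * ((7 / 8 * A) * (7 / 8 * B)) := by
            have : 0 ≤ x ^ 2 * A * B := by positivity
            nlinarith
        _ ≤ (x - 1 / (768 * √r)) ^ 2 * ((∑ i, a i * χ i) * ∑ j, b j * ψ j) :=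
            mul_le_mul h2 h3 (by positivity) (by positivity)
        _ = _ := by ring
  · set p := (x - 1 / (768 * √(r : ℝ))) ^ 2 with hp
    set τ := 1 / (8 * x * √(r : ℝ)) with hτ
    set θ := Real.exp (-1) * Real.sinh τ with hθ
    have hτ0 : 0 < τ := by positivity
    have hθτ : τ / 3 ≤ θ := by
      have h1 : τ ≤ Real.sinh τ := Real.self_le_sinh_iff.2 hτ0.le
      have h2 : 1 / 3 ≤ Real.exp (-1) := by
        rw [Real.exp_neg, one_div]
        exact inv_anti₀ (Real.exp_pos _) Real.exp_one_lt_three.le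
      calc τ / 3 = 1 / 3 * τ := by ring
        _ ≤ _ := mul_le_mul h2 h1 hτ0.le (Real.exp_pos _).le
    have hpx : x ^ 2 - θ * x ^ 2 / 16 ≤ p := by
      have h1 : τ / 3 * x ^ 2 / 16 = 2 * x * (1 / (768 * √(r : ℝ))) := by
        rw [hτ]; field_simp; norm_num
      have h2 := mul_le_mul_of_nonneg_right hθτ (sq_nonneg x)
      nlinarith [sq_nonneg (1 / (768 * √(r : ℝ)))]
    have hp2 : p ≤ 1 / 2 := by
      refine le_trans (pow_le_pow_left₀ ?_ ?_ 2) hx2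
      · have : 1 / (768 * √(r : ℝ)) = 1 / (2 * √r) / 384 := by field_simp; norm_num
        rw [this]
        linarith
      · have : 0 < 1 / (768 * √(r : ℝ)) := by positivity
        linarith
    set α := √(8 * (x ^ 2 * B)) with hα
    set β := √(8 * (r / B)) with hβ
    have hα0 : 0 < α := Real.sqrt_pos.2 (by positivity)
    have hβ0 : 0 < β := Real.sqrt_pos.2 (by positivity)
    have hαβ : α * β = 8 * x * √r := by
      rw [hα, hβ, ← Real.sqrt_mul (by positivity)]
      have : 8 * (x ^ 2 * B) * (8 * (r / B)) = (8 * x) ^ 2 * r := by field_simp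
      rw [this, Real.sqrt_mul (by positivity), Real.sqrt_sq (by positivity)]
    obtain ⟨f, g, hf, hg, hfg⟩ := exists_rounding
      (fun i => (χ i * α⁻¹) • u i) (fun j => (ψ j * (β * √(b j))⁻¹) • v j)
      (fun i => by
        by_cases h : ‖u i‖ ^ 2 ≤ 8 * (x ^ 2 * B)
        · have : ‖u i‖ ≤ α := Real.le_sqrt_of_sq_le h
          simp only [hχ, if_pos h, one_mul, norm_smul, norm_inv, Real.norm_eq_abs, abs_of_pos hα0]
          rw [inv_mul_eq_div]
          exact (div_le_one hα0).2 this
        · simp [hχ, h])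
      (fun j => by
        by_cases h : ‖v j‖ ^ 2 ≤ 8 * (r / B) * b j
        · have : ‖v j‖ ≤ β * √(b j) := by
            rw [hβ, ← Real.sqrt_mul (by positivity)]
            exact Real.le_sqrt_of_sq_le h
          simp only [hψ, if_pos h, one_mul, norm_smul, norm_inv, Real.norm_eq_abs,
            abs_of_nonneg (mul_nonneg hβ0.le (Real.sqrt_nonneg (b j)))]
          rw [inv_mul_eq_div]
          exact div_le_one_of_le₀ this (by positivity)
        · simp [hψ, h])
      (fun i j => a i * b j * (M i j - p))
    have hval : ∀ i j, a i * b j * (M i j - p) * (4 - Real.exp (-1) * Real.sinh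
        (inner ℝ ((χ i * α⁻¹) • u i) ((ψ j * (β * √(b j))⁻¹) • v j))) =
        4 * (a i * b j * M i j) - 4 * p * (a i * b j) -
          θ * (1 - p) * (a i * χ i * (b j * ψ j) * M i j) := fun i j => by
      rcases (hb0 j).eq_or_lt with hb | hb
      · simp [← hb]
      · have hsb : √(b j) ≠ 0 := (Real.sqrt_pos.2 hb).ne'
        have hin : inner ℝ ((χ i * α⁻¹) • u i) ((ψ j * (β * √(b j))⁻¹) • v j) =
            χ i * ψ j * M i j * τ := by
          rw [real_inner_smul_left, real_inner_smul_right, huv, hτ, ← hαβ]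
          field_simp
        rw [hin]
        rcases hχ01 i with h1 | h1 <;> rcases hψ01 j with h2 | h2 <;>
          rcases hM i j with h3 | h3 <;> simp only [h1, h2, h3, hθ] <;>
          simp only [zero_mul, mul_zero, one_mul, mul_one, Real.sinh_zero] <;> ring
    have hABsum : ∑ i, a i * ∑ j, b j = A * B := (Finset.sum_mul _ _ _).symm
    simp only [hval, Finset.sum_sub_distrib, ← Finset.mul_sum, hD] at hfg
    have hL : ∑ i, ∑ j, a i * ((2 + f i) / 4) * (b j * ((2 - g j) / 4)) * M i j -
        p * (∑ i, a i * ((2 + f i) / 4)) * ∑ j, b j * ((2 - g j) / 4) =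
        1 / 16 * ∑ i, ∑ j, a i * b j * (M i j - p) * ((2 + f i) * (2 - g j)) := by
      rw [mul_assoc, Finset.sum_mul_sum, Finset.mul_sum, Finset.mul_sum, ← Finset.sum_sub_distrib]
      refine Finset.sum_congr rfl fun i _ => ?_
      rw [Finset.mul_sum, Finset.mul_sum, ← Finset.sum_sub_distrib]
      exact Finset.sum_congr rfl fun j _ => by ring
    have hgain : 4 * (x ^ 2 * A * B) - 4 * p * (A * B) ≤
        θ * (1 - p) * ∑ i, ∑ j, a i * χ i * (b j * ψ j) * M i j := by
      have h0 : 0 ≤ θ * (1 - p) := mul_nonneg (by linarith) (by linarith)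
      have h1 : θ * x ^ 2 / 4 ≤ θ * (1 - p) * (x ^ 2 / 2) := by
        have : 0 ≤ θ * x ^ 2 * (1 / 2 - p) :=
          mul_nonneg (mul_nonneg (by linarith) (sq_nonneg x)) (by linarith)
        linarith
      have h2 : (x ^ 2 - p) * 4 ≤ θ * (1 - p) * (x ^ 2 / 2) := by linarith
      calc 4 * (x ^ 2 * A * B) - 4 * p * (A * B) = (x ^ 2 - p) * 4 * (A * B) := by ring
        _ ≤ θ * (1 - p) * (x ^ 2 / 2) * (A * B) :=
            mul_le_mul_of_nonneg_right h2 (by positivity)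
        _ = θ * (1 - p) * (x ^ 2 / 2 * A * B) := by ring
        _ ≤ _ := mul_le_mul_of_nonneg_left (not_le.1 hcase).le h0
    have hf' : ∀ i, 1 / 4 ≤ (2 + f i) / 4 ∧ (2 + f i) / 4 ≤ 1 := fun i => by
      constructor <;> linarith [abs_le.1 (hf i)]
    have hg' : ∀ j, 1 / 4 ≤ (2 - g j) / 4 ∧ (2 - g j) / 4 ≤ 1 := fun j => by
      constructor <;> linarith [abs_le.1 (hg j)]
    refine ⟨fun i => a i * ((2 + f i) / 4), fun j => b j * ((2 - g j) / 4),
      fun i => mul_nonneg (ha0 i) (by linarith [hf' i]),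
      fun i => mul_le_of_le_one_right (ha0 i) (hf' i).2,
      fun j => mul_nonneg (hb0 j) (by linarith [hg' j]),
      fun j => mul_le_of_le_one_right (hb0 j) (hg' j).2, ?_, ?_, ?_⟩
    · rw [Finset.sum_div]
      refine Finset.sum_le_sum fun i _ => ?_
      rw [div_eq_mul_one_div]
      exact mul_le_mul_of_nonneg_left (hf' i).1 (ha0 i)
    · rw [Finset.sum_div]
      refine Finset.sum_le_sum fun j _ => ?_
      rw [div_eq_mul_one_div]
      exact mul_le_mul_of_nonneg_left (hg' j).1 (hb0 j)
    · rw [hABsum] at hfg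
      linarith

/-- Iterated density decrement. -/
theorem exists_zero_submatrix_of_density_le {ι κ : Type*} [Fintype ι] [Fintype κ]
    (M : Matrix ι κ ℝ) (hM : ∀ i j, M i j = 0 ∨ M i j = 1) {r : ℕ} (hr0 : 0 < r)
    (hr : M.rank ≤ r) (k : ℕ) :
    ∀ (a : ι → ℝ) (b : κ → ℝ), (∀ i, 0 ≤ a i) → (∀ i, a i ≤ 1) → (∀ j, 0 ≤ b j) →
      (∀ j, b j ≤ 1) → 0 < ∑ i, a i → 0 < ∑ j, b j → ∀ x : ℝ, 0 ≤ x → x ^ 2 ≤ 1 / 2 →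
      x ≤ 1 / (2 * √r) + k * (1 / (768 * √r)) →
      ∑ i, ∑ j, a i * b j * M i j ≤ x ^ 2 * (∑ i, a i) * ∑ j, b j →
      ∃ (X : Finset ι) (Y : Finset κ), (∑ i, a i) / (2 * 4 ^ k) ≤ X.card ∧
        (∑ j, b j) / (2 * 4 ^ k) ≤ Y.card ∧ ∀ i ∈ X, ∀ j ∈ Y, M i j = 0 := by
  have hr0' : (0 : ℝ) < r := by exact_mod_cast hr0
  have hs : 0 < √(r : ℝ) := Real.sqrt_pos.2 hr0'
  have hbase : (1 / (2 * √(r : ℝ))) ^ 2 = 1 / (4 * r) := by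
    rw [div_pow, mul_pow, Real.sq_sqrt hr0'.le]
    norm_num
  have hM0 : ∀ i j, 0 ≤ M i j := fun i j => by rcases hM i j with h | h <;> simp [h]
  induction k with
  | zero =>
    intro a b ha0 ha1 hb0 hb1 hA hB x hx0 hx2 hx hD
    have h := exists_zero_submatrix_of_sparse M hM hr0 hr a b ha0 ha1 hb0 hb1 hB (hD.trans ?_)
    · simpa using h
    · rw [← hbase]
      gcongr
      simpa using hx
  | succ k ih =>
    intro a b ha0 ha1 hb0 hb1 hA hB x hx0 hx2 hx hD
    set A := ∑ i, a i
    set B := ∑ j, b j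
    set D := ∑ i, ∑ j, a i * b j * M i j
    have hD0 : 0 ≤ D := Finset.sum_nonneg fun i _ => Finset.sum_nonneg fun j _ =>
      mul_nonneg (mul_nonneg (ha0 i) (hb0 j)) (hM0 i j)
    set y := √(D / (A * B))
    have hy2 : y ^ 2 = D / (A * B) := Real.sq_sqrt (by positivity)
    have hyD : D = y ^ 2 * A * B := by
      rw [hy2]; field_simp
    have hyx : y ≤ x := Real.sqrt_le_iff.2 ⟨hx0, by
      rw [div_le_iff₀ (by positivity)]
      linarith⟩
    have hy0 : 0 ≤ y := Real.sqrt_nonneg _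
    rcases le_or_gt y (1 / (2 * √r)) with hy | hy
    · obtain ⟨X, Y, hX, hY, h⟩ := ih a b ha0 ha1 hb0 hb1 hA hB y hy0
        ((pow_le_pow_left₀ hy0 hyx 2).trans hx2) (hy.trans (by simp; positivity)) hyD.le
      refine ⟨X, Y, le_trans ?_ hX, le_trans ?_ hY, h⟩
      · gcongr <;> norm_num
      · gcongr <;> norm_num
    · obtain ⟨a', b', ha0', ha1', hb0', hb1', hA', hB', hD'⟩ := exists_density_decrement_s15 M hM hr0 hr
        a b ha0 hb0 hA hB hy.le ((pow_le_pow_left₀ hy0 hyx 2).trans hx2) hyD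
      have hz0 : 0 ≤ y - 1 / (768 * √r) := by
        have h1 : 1 / (768 * √(r : ℝ)) = 1 / (2 * √r) / 384 := by field_simp; norm_num
        have h2 : 0 < 1 / (2 * √(r : ℝ)) := by positivity
        rw [h1]
        linarith
      have hz1 : y - 1 / (768 * √r) ≤ x := by
        have : 0 < 1 / (768 * √(r : ℝ)) := by positivity
        linarith
      obtain ⟨X, Y, hX, hY, h⟩ := ih a' b' ha0' (fun i => (ha1' i).trans (ha1 i)) hb0'
        (fun j => (hb1' j).trans (hb1 j)) (by linarith) (by linarith) _ hz0
        ((pow_le_pow_left₀ hz0 hz1 2).trans hx2) (by push_cast at hx; linarith) hD'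
      refine ⟨X, Y, le_trans ?_ hX, le_trans ?_ hY, h⟩
      · calc A / (2 * 4 ^ (k + 1)) = A / 4 / (2 * 4 ^ k) := by field_simp; ring
          _ ≤ _ := by gcongr
      · calc B / (2 * 4 ^ (k + 1)) = B / 4 / (2 * 4 ^ k) := by field_simp; ring
          _ ≤ _ := by gcongr

/-- A binary matrix of rank at most `r ≥ 1`, at least half of whose entries vanish, contains a zero
submatrix of relative size `2 ^ (-O(√r))`. -/
theorem exists_zero_submatrix_of_half {ι κ : Type*} [Fintype ι] [Fintype κ] [Nonempty ι]
    [Nonempty κ] (M : Matrix ι κ ℝ) (hM : ∀ i j, M i j = 0 ∨ M i j = 1) {r : ℕ} (hr0 : 0 < r)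
    (hr : M.rank ≤ r)
    (hD : ∑ i, ∑ j, M i j ≤ 1 / 2 * Fintype.card ι * Fintype.card κ) :
    ∃ (X : Finset ι) (Y : Finset κ),
      (Fintype.card ι : ℝ) / 2 ^ (1539 * √r) ≤ X.card ∧
      (Fintype.card κ : ℝ) / 2 ^ (1539 * √r) ≤ Y.card ∧ ∀ i ∈ X, ∀ j ∈ Y, M i j = 0 := by
  have hr1 : (1 : ℝ) ≤ r := by exact_mod_cast hr0
  have hs : 1 ≤ √(r : ℝ) := Real.one_le_sqrt.2 hr1
  set k := ⌈768 * √(r : ℝ)⌉₊ with hk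
  have hk1 : 768 * √(r : ℝ) ≤ k := Nat.le_ceil _
  have hk2 : (k : ℝ) ≤ 768 * √(r : ℝ) + 1 := (Nat.ceil_lt_add_one (by positivity)).le
  have hhalf : √(1 / 2 : ℝ) ^ 2 = 1 / 2 := Real.sq_sqrt (by norm_num)
  obtain ⟨X, Y, hX, hY, h⟩ := exists_zero_submatrix_of_density_le M hM hr0 hr k
    (fun _ => 1) (fun _ => 1) (fun _ => zero_le_one) (fun _ => le_rfl) (fun _ => zero_le_one)
    (fun _ => le_rfl) (by simp [Fintype.card_pos]) (by simp [Fintype.card_pos])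
    (√(1 / 2)) (Real.sqrt_nonneg _) hhalf.le
    (by
      have h1 : √(1 / 2 : ℝ) ≤ 1 := Real.sqrt_le_one.2 (by norm_num)
      have h2 : 1 ≤ k * (1 / (768 * √(r : ℝ))) := by
        rw [mul_one_div]
        exact (one_le_div (by positivity)).2 hk1
      have h3 : 0 < 1 / (2 * √(r : ℝ)) := by positivity
      linarith)
    (by rw [hhalf]; simpa using hD)
  have hpow : (2 : ℝ) * 4 ^ k ≤ 2 ^ (1539 * √(r : ℝ)) := by
    have : (2 : ℝ) * 4 ^ k = 2 ^ ((2 * k + 1 : ℕ) : ℝ) := by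
      rw [Real.rpow_natCast, pow_succ, pow_mul]
      norm_num [mul_comm]
    rw [this]
    refine Real.rpow_le_rpow_of_exponent_le one_le_two ?_
    push_cast
    linarith
  refine ⟨X, Y, le_trans ?_ hX, le_trans ?_ hY, h⟩
  · simp only [Finset.sum_const, Finset.card_univ, nsmul_eq_mul, mul_one]
    gcongr
  · simp only [Finset.sum_const, Finset.card_univ, nsmul_eq_mul, mul_one]
    gcongr

/-- Every binary `m×n` matrix of rank at most `r` contains an
`(m·2^{-O(√r)}) × (n·2^{-O(√r)})` all-0 or all-1 submatrix. -/
theorem stmt15 :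
    ∃ c : ℝ, 0 < c ∧
      ∀ (m n r : ℕ) (M : Matrix (Fin m) (Fin n) ℝ),
        (∀ i j, M i j = 0 ∨ M i j = 1) →
        M.rank ≤ r →
        ∃ (X : Finset (Fin m)) (Y : Finset (Fin n)),
          (m : ℝ) / 2 ^ (c * Real.sqrt r) ≤ X.card ∧
          (n : ℝ) / 2 ^ (c * Real.sqrt r) ≤ Y.card ∧
          ((∀ i ∈ X, ∀ j ∈ Y, M i j = 0) ∨ (∀ i ∈ X, ∀ j ∈ Y, M i j = 1)) := by
  refine ⟨3078, by norm_num, fun m n r M hM hr => ?_⟩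
  have hle : ∀ N : ℕ, (N : ℝ) / 2 ^ (3078 * √(r : ℝ)) ≤ N := fun N =>
    div_le_self N.cast_nonneg (Real.one_le_rpow one_le_two (by positivity))
  have huniv : (∀ i j, M i j = 0) → ∃ (X : Finset (Fin m)) (Y : Finset (Fin n)),
      (m : ℝ) / 2 ^ (3078 * √(r : ℝ)) ≤ X.card ∧ (n : ℝ) / 2 ^ (3078 * √(r : ℝ)) ≤ Y.card ∧
      ((∀ i ∈ X, ∀ j ∈ Y, M i j = 0) ∨ (∀ i ∈ X, ∀ j ∈ Y, M i j = 1)) := fun h =>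
    ⟨Finset.univ, Finset.univ, by simpa using hle m, by simpa using hle n,
      Or.inl fun i _ j _ => h i j⟩
  rcases Nat.eq_zero_or_pos m with rfl | hm
  · exact huniv fun i => i.elim0
  rcases Nat.eq_zero_or_pos n with rfl | hn
  · exact huniv fun _ j => j.elim0
  rcases Nat.eq_zero_or_pos r with rfl | hr0
  · refine huniv fun i j => ?_
    have h : Module.finrank ℝ (Submodule.span ℝ (Set.range M.row)) = 0 := by
      rw [← Matrix.rank_eq_finrank_span_row]
      exact Nat.le_zero.1 hr
    rw [Submodule.finrank_eq_zero, Submodule.span_eq_bot] at h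
    exact congrFun (h _ ⟨i, rfl⟩) j
  have : Nonempty (Fin m) := ⟨⟨0, hm⟩⟩
  have : Nonempty (Fin n) := ⟨⟨0, hn⟩⟩
  have hr1 : (1 : ℝ) ≤ r := by exact_mod_cast hr0
  rcases le_total (∑ i, ∑ j, M i j) (1 / 2 * Fintype.card (Fin m) * Fintype.card (Fin n)) with
    hD | hD
  · obtain ⟨X, Y, hX, hY, h⟩ := exists_zero_submatrix_of_half M hM hr0 hr hD
    rw [Fintype.card_fin] at hX hY
    refine ⟨X, Y, le_trans ?_ hX, le_trans ?_ hY, Or.inl h⟩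
    · gcongr <;> norm_num
    · gcongr <;> norm_num
  · set N : Matrix (Fin m) (Fin n) ℝ := Matrix.vecMulVec 1 1 - M with hN
    have hNij : ∀ i j, N i j = 1 - M i j := fun i j => by simp [hN]
    have hNr : N.rank ≤ r + 1 := by
      have h := Matrix.rank_sub_le (Matrix.vecMulVec (1 : Fin m → ℝ) (1 : Fin n → ℝ)) M
      have h1 := Matrix.rank_vecMulVec_le (1 : Fin m → ℝ) (1 : Fin n → ℝ)
      rw [← hN] at h
      omega
    obtain ⟨X, Y, hX, hY, h⟩ := exists_zero_submatrix_of_half N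
      (fun i j => by rw [hNij]; rcases hM i j with h | h <;> simp [h]) r.succ_pos hNr
      (by
        simp only [hNij, Finset.sum_sub_distrib, Finset.sum_const, Finset.card_univ, nsmul_eq_mul,
          mul_one]
        linarith)
    rw [Fintype.card_fin] at hX hY
    have hexp : 1539 * √((r + 1 : ℕ) : ℝ) ≤ 3078 * √(r : ℝ) := by
      have : √((r + 1 : ℕ) : ℝ) ≤ 2 * √(r : ℝ) := by
        rw [Real.sqrt_le_left (by positivity), mul_pow, Real.sq_sqrt (by positivity)]
        push_cast
        linarith
      linarith
    refine ⟨X, Y, le_trans ?_ hX, le_trans ?_ hY, Or.inr fun i hi j hj => ?_⟩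
    · gcongr
      norm_num
    · gcongr
      norm_num
    · have := h i hi j hj
      rw [hNij] at this
      linarith
end
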